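/- arXiv:1510.03769 — 3 statements merged into one kernel-verified Lean document; each statement's English description precedes it below -/
import Mathlib

section
/- Let (i, j, k₀) be a permutation of (0, 1, 2), assume θθ̄ ≠ 0, and suppose A, B, C, D are elements of a field extension F of L satisfying the system: 1 + Aφ_i + Cψ_i = 0; θ(1 + Aφ_j + Cψ_j) = Bφ_j + Dψ_j; θ̄(1 + Aφ_{k₀} + Cψ_{k₀}) = Bφ_{k₀} + Dψ_{k₀}; and (Bφ₀ + Dψ₀)(Bφ₁ + Dψ₁)(Bφ₂ + Dψ₂) = dθθ̄. Then for all x, y ∈ F, ∏_{m=0}^{2}(x + φ_m(Ax + By) + ψ_m(Cx + Dy)) = d·y·(x + θy)(x + θ̄y); that is, the line z = Ax + By, w = Cx + Dy lies on the cubic surface X. -/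
open NumberField IsDedekindDomain
open scoped TensorProduct Multiplicative

theorem Fin.prod_univ_three_of_ne {M : Type*} [CommMonoid M] (f : Fin 3 → M) {i j l : Fin 3}
    (hij : i ≠ j) (hil : i ≠ l) (hjl : j ≠ l) : ∏ m, f m = f i * f j * f l := by
  have huniv : (Finset.univ : Finset (Fin 3)) = {i, j, l} := by
    decide +revert
  rw [huniv, Finset.prod_insert (by simp [hij, hil]), Finset.prod_pair hjl, mul_assoc]

/-- a solution `(A, B, C, D)` of the system of equations
determines a line `z = A x + B y`, `w = C x + D y` lying on the cubic surface `X`. -/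
theorem bsd_line_on_surface
    -- `k` is a number field and `L/k` a Galois extension with `Gal(L/k) ≃ S₃`
    (k K L : Type*) [Field k] [NumberField k] [Field K] [NumberField K]
    [Field L] [NumberField L]
    [Algebra k K] [Algebra k L] [Algebra K L] [IsScalarTower k K L]
    [IsGalois k L]
    (hGalS3 : Nonempty ((L ≃ₐ[k] L) ≃* Equiv.Perm (Fin 3)))
    -- `K` is the (unique) quadratic extension of `k` contained in `L`
    (hK2 : Module.finrank k K = 2)
    -- `φ = φ₀, φ₁, φ₂` and `ψ = ψ₀, ψ₁, ψ₂` are families of elements of `𝓞 L`,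
    -- permuted compatibly by `Gal(L/k)` (Galois conjugates over `k`)
    (φ ψ : Fin 3 → (𝓞 L)) (φL ψL : Fin 3 → L)
    (hφL : ∀ i, φL i = algebraMap (𝓞 L) L (φ i))
    (hψL : ∀ i, ψL i = algebraMap (𝓞 L) L (ψ i))
    (hconj : ∀ σ : L ≃ₐ[k] L, ∃ π : Equiv.Perm (Fin 3),
        ∀ i, σ (φL i) = φL (π i) ∧ σ (ψL i) = ψL (π i))
    -- `(1, φ, ψ)` is a `k`-basis of a cubic extension `K₀` of `k` contained in `L`
    (K₀ : IntermediateField k L) (hK₀3 : Module.finrank k K₀ = 3)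
    (hbasis : Submodule.span k ({1, φL 0, ψL 0} : Set L)
        = Subalgebra.toSubmodule K₀.toSubalgebra)
    -- `θ ∈ 𝓞 K`, with Galois conjugate `θ̄` over `k`
    (θ θb : 𝓞 K) (θL θbL : L)
    (hθL : θL = algebraMap K L (algebraMap (𝓞 K) K θ))
    (hθbL : θbL = algebraMap K L (algebraMap (𝓞 K) K θb))
    (hθconj : ∃ σ : L ≃ₐ[k] L, σ θL = θbL)
    -- `d ∈ 𝓞 k` is nonzero
    (d : 𝓞 k) (hd : d ≠ 0)
    (dL : L) (hdL : dL = algebraMap k L (algebraMap (𝓞 k) k d))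
    -- a field extension `F` of `L`
    (F : Type*) [Field F] [Algebra L F]
    (φF ψF : Fin 3 → F)
    (hφF : ∀ i, φF i = algebraMap L F (φL i))
    (hψF : ∀ i, ψF i = algebraMap L F (ψL i))
    (θF θbF dF : F)
    (hθF : θF = algebraMap L F θL)
    (hθbF : θbF = algebraMap L F θbL)
    (hdF : dF = algebraMap L F dL)
    -- `(i, j, k₀)` is a permutation of `(0, 1, 2)`
    (i j k₀ : Fin 3) (hij : i ≠ j) (hik : i ≠ k₀) (hjk : j ≠ k₀)
    -- assume `θ θ̄ ≠ 0`
    (hθθb : θ * θb ≠ 0)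
    -- `(A, B, C, D)` solves the system of equations defining the lines
    (A B C D : F)
    (hline1 : 1 + A * φF i + C * ψF i = 0)
    (hline2 : θF * (1 + A * φF j + C * ψF j) = B * φF j + D * ψF j)
    (hline3 : θbF * (1 + A * φF k₀ + C * ψF k₀) = B * φF k₀ + D * ψF k₀)
    (hline4 : (B * φF 0 + D * ψF 0) * (B * φF 1 + D * ψF 1) * (B * φF 2 + D * ψF 2)
        = dF * (θF * θbF)) :
    -- then the line `z = A x + B y`, `w = C x + D y` lies on `X`
    ∀ x y : F,
      ∏ m : Fin 3, (x + φF m * (A * x + B * y) + ψF m * (C * x + D * y))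
        = dF * y * ((x + θF * y) * (x + θbF * y)) := by
  intro x y
  have hne : θF * θbF ≠ 0 := by
    rw [hθF, hθbF, hθL, hθbL]
    simp only [← map_mul]
    simpa using hθθb
  rw [← Fin.prod_univ_three (fun m => B * φF m + D * ψF m),
    Fin.prod_univ_three_of_ne _ hij hik hjk, ← hline2, ← hline3] at hline4
  have hd' : (B * φF i + D * ψF i) * (1 + A * φF j + C * ψF j)
      * (1 + A * φF k₀ + C * ψF k₀) = dF :=
    mul_right_cancel₀ hne (by rw [← hline4]; ring)
  have split (m : Fin 3) : x + φF m * (A * x + B * y) + ψF m * (C * x + D * y)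
      = (1 + A * φF m + C * ψF m) * x + (B * φF m + D * ψF m) * y := by ring
  simp only [split]
  rw [Fin.prod_univ_three_of_ne _ hij hik hjk, hline1, ← hline2, ← hline3, ← hd']
  ring
end

section
/- If 𝒫 is a prime of O_K dividing dO_K that splits completely in L, then the base change X_K of X to K has a K_𝒫-point: X(K_𝒫) ≠ ∅. (Indeed, the reduction of X modulo 𝒫 is a union of three lines, each defined over the residue field of 𝒫.) -/
open NumberField IsDedekindDomain
open scoped TensorProduct Multiplicative

/-- The defining equation of the Birch--Swinnerton-Dyer cubic surface
`∏ i, (x + φᵢ z + ψᵢ w) = d • y • (x + θ y) • (x + θ̄ y)`, evaluated at a point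
`(x, y, z, w)` with coordinates in a field `F` that is an algebra over the base field `k`.
The coefficients `φᵢ, ψᵢ, d, θ, θ̄` live in `L`, so the equation is read in the ring
`L ⊗[k] F`; since the equation is in fact defined over `k` (its coefficients are the
symmetric functions of the Galois-conjugate data), this faithfully interprets
"`(x, y, z, w)` is an `F`-point of the surface `X`". -/
def BSDEqn (k : Type*) {L : Type*} [Field k] [Field L] [Algebra k L]
    (φL ψL : Fin 3 → L) (dL θL θbL : L)
    {F : Type*} [Field F] [Algebra k F] (x y z w : F) : Prop :=
  (∏ i : Fin 3, ((1 : L) ⊗ₜ[k] x + (φL i) ⊗ₜ[k] z + (ψL i) ⊗ₜ[k] w))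
    = (dL ⊗ₜ[k] y) * ((1 : L) ⊗ₜ[k] x + θL ⊗ₜ[k] y) * ((1 : L) ⊗ₜ[k] x + θbL ⊗ₜ[k] y)

/-- `X(F) ≠ ∅` : the BSD cubic surface has a nontrivial point with coordinates in `F`. -/
def BSDHasPoint (k : Type*) {L : Type*} [Field k] [Field L] [Algebra k L]
    (φL ψL : Fin 3 → L) (dL θL θbL : L)
    (F : Type*) [Field F] [Algebra k F] : Prop :=
  ∃ x y z w : F, ¬(x = 0 ∧ y = 0 ∧ z = 0 ∧ w = 0) ∧ BSDEqn k φL ψL dL θL θbL x y z w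

section

open WithZero WithZeroMulInt

/-- If `w` lies over `v` with `e = f = 1`, every integer of the extension is `w`-adically
approximated by integers of the base. -/
theorem exists_intValuation_sub_algebraMap_le {A B : Type*} [CommRing A] [IsDedekindDomain A]
    [CommRing B] [IsDedekindDomain B] [Algebra A B] [Module.IsTorsionFree A B]
    (v : HeightOneSpectrum A) (w : HeightOneSpectrum B) [w.asIdeal.LiesOver v.asIdeal]
    (he : v.asIdeal.ramificationIdx' w.asIdeal = 1)
    (hf : ∀ x : B, ∃ a : A, x - algebraMap A B a ∈ w.asIdeal) (x : B) (n : ℕ) :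
    ∃ a : A, w.intValuation (x - algebraMap A B a) ≤ exp (-(n : ℤ)) := by
  obtain ⟨π, hπ⟩ := v.intValuation_exists_uniformizer
  have hwπ : w.intValuation (algebraMap A B π) = exp (-1 : ℤ) := by
    rw [← HeightOneSpectrum.intValuation_liesOver v w, he, pow_one, hπ]
  induction n with
  | zero => exact ⟨0, by simpa using w.intValuation_le_one x⟩
  | succ n ih =>
    obtain ⟨a, ha⟩ := ih
    have hwπn : w.intValuation (algebraMap A B π ^ n) = exp (-(n : ℤ)) := by
      rw [map_pow, hwπ, ← exp_nsmul]; simp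
    obtain ⟨c, hc⟩ := w.exists_intValuation_mul_sub_lt (ha.trans_eq hwπn.symm)
      (Multiplicative.ofAdd (-(n : ℤ)))
    obtain ⟨b, hb⟩ := hf c
    refine ⟨a + b * π ^ n, ?_⟩
    have key : x - algebraMap A B (a + b * π ^ n)
        = (x - algebraMap A B a - c * algebraMap A B π ^ n)
          + (c - algebraMap A B b) * algebraMap A B π ^ n := by
      simp only [map_add, map_mul, map_pow]; ring
    have hlt : ∀ y : ℤᵐ⁰, y < exp (-(n : ℤ)) → y ≤ exp (-((n + 1 : ℕ) : ℤ)) := by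
      intro y hy
      rcases eq_or_ne y 0 with rfl | hy0
      · simp
      · rw [← log_le_iff_le_exp hy0]
        rw [← log_lt_iff_lt_exp hy0] at hy
        push_cast; omega
    rw [key]
    refine (w.intValuation.map_add _ _).trans (max_le (hlt _ hc) (hlt _ ?_))
    rw [map_mul, hwπn]
    have := (w.intValuation_lt_one_iff_mem _).2 hb
    exact mul_lt_of_lt_one_left (by simp) this

/-- If `w` lies over `v` with `e = f = 1`, a polynomial over `K` that has an integral root in `L`
has a root in `K_v`. -/
theorem exists_root_adicCompletion {K L : Type*} [Field K] [NumberField K]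
    [Field L] [NumberField L] [Algebra K L]
    (v : HeightOneSpectrum (𝓞 K)) (w : HeightOneSpectrum (𝓞 L)) [w.asIdeal.LiesOver v.asIdeal]
    (he : v.asIdeal.ramificationIdx' w.asIdeal = 1)
    (hf : ∀ x : 𝓞 L, ∃ a : 𝓞 K, x - algebraMap (𝓞 K) (𝓞 L) a ∈ w.asIdeal)
    (P : Polynomial K) (Q : Polynomial (𝓞 L))
    (hPQ : P.map (algebraMap K L) = Q.map (algebraMap (𝓞 L) L)) (x : 𝓞 L) (hx : Q.IsRoot x) :
    ∃ y : v.adicCompletion K, P.aeval y = 0 := by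
  choose a ha using exists_intValuation_sub_algebraMap_le v w he hf x
  let N := Ideal.absNorm v.asIdeal
  let ι : K →+* v.adicCompletion K := FinitePlace.embedding v
  have hN1 : (1 : ℝ) < N := by exact_mod_cast HeightOneSpectrum.one_lt_absNorm v
  have hnorm : ∀ (z : K) (n : ℕ), v.valuation K z ≤ exp (-(n : ℤ)) →
      ‖ι z‖ ≤ ((N : ℝ)⁻¹) ^ n := by
    intro z n hz
    rw [FinitePlace.norm_embedding']
    have h := (toNNReal_strictMono (e := (N : NNReal))
      (HeightOneSpectrum.one_lt_absNorm_nnreal v)).monotone hz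
    have h' : (toNNReal (HeightOneSpectrum.absNorm_ne_zero v) (v.valuation K z) : ℝ) ≤
      ((toNNReal (HeightOneSpectrum.absNorm_ne_zero v) (exp (-(n : ℤ))) : NNReal) : ℝ) := by
        exact_mod_cast h
    refine h'.trans_eq ?_
    rw [toNNReal_neg_apply _ (by simp)]
    change (((N : NNReal) ^ (-(n : ℤ)) : NNReal) : ℝ) = _
    simp
  have hcomp : ∀ z : K, v.valuation K z = w.valuation L (algebraMap K L z) := by
    intro z
    rw [← HeightOneSpectrum.valuation_liesOver L v w, he, pow_one]
  let u : ℕ → v.adicCompletion K := fun n ↦ ι (algebraMap (𝓞 K) K (a n))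
  have hdist : ∀ n, dist (u n) (u (n + 1)) ≤ 1 * ((N : ℝ)⁻¹) ^ n := by
    intro n
    rw [dist_eq_norm, one_mul, ← map_sub]
    apply hnorm
    rw [← map_sub, HeightOneSpectrum.valuation_of_algebraMap]
    have h1 := HeightOneSpectrum.intValuation_liesOver v w (a n - a (n + 1))
    rw [he, pow_one] at h1
    rw [h1, map_sub, ← sub_sub_sub_cancel_left (c := x)]
    refine (w.intValuation.map_sub _ _).trans (max_le ((ha (n + 1)).trans ?_) (ha n))
    rw [exp_le_exp]; push_cast; omega
  obtain ⟨y, hy⟩ := cauchySeq_tendsto_of_complete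
    (cauchySeq_of_le_geometric _ 1 (inv_lt_one_of_one_lt₀ hN1) hdist)
  refine ⟨y, ?_⟩
  have h1 : Filter.Tendsto (fun n ↦ P.aeval (u n)) Filter.atTop (nhds (P.aeval y)) := by
    simp only [Polynomial.aeval_def, Polynomial.eval₂_eq_eval_map]
    exact ((Polynomial.continuous _).tendsto y).comp hy
  refine tendsto_nhds_unique h1 (squeeze_zero_norm (a := fun n ↦ ((N : ℝ)⁻¹) ^ n) ?_
    (tendsto_pow_atTop_nhds_zero_of_lt_one (by positivity) (inv_lt_one_of_one_lt₀ hN1)))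
  intro n
  have h2 : P.aeval (u n) = ι (P.eval (algebraMap (𝓞 K) K (a n))) := by
    have : u n = algebraMap K _ (algebraMap (𝓞 K) K (a n)) := rfl
    rw [this, Polynomial.aeval_algebraMap_apply]
    simp only [Polynomial.coe_aeval_eq_eval]
    rfl
  rw [h2]
  apply hnorm
  rw [hcomp, ← Polynomial.eval_map_apply, hPQ, ← IsScalarTower.algebraMap_apply,
    IsScalarTower.algebraMap_apply (𝓞 K) (𝓞 L) L, Polynomial.eval_map_apply,
    HeightOneSpectrum.valuation_of_algebraMap]
  obtain ⟨c, hc⟩ := Polynomial.sub_dvd_eval_sub x (algebraMap (𝓞 K) (𝓞 L) (a n)) Q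
  rw [hx.eq_zero, zero_sub] at hc
  rw [← Valuation.map_neg, hc, map_mul]
  exact (mul_le_of_le_one_right' (w.intValuation_le_one _)).trans (ha n)

end

/-- Three distinct primes above `p` in a cubic extension have ramification index one and
trivial residue field extension. -/
theorem ramificationIdx'_eq_one_and_exists_sub_mem {K L : Type*} [Field K] [NumberField K]
    [Field L] [NumberField L] [Algebra K L] (hKL : Module.finrank K L = 3)
    (p : Ideal (𝓞 K)) [p.IsPrime] (hp : p ≠ ⊥) (Q : Fin 3 → Ideal (𝓞 L)) (hQ : Function.Injective Q)
    [∀ i, (Q i).IsPrime] [∀ i, (Q i).LiesOver p] (i : Fin 3) :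
    p.ramificationIdx' (Q i) = 1 ∧ ∀ x : 𝓞 L, ∃ a : 𝓞 K, x - algebraMap (𝓞 K) (𝓞 L) a ∈ Q i := by
  have hpm : p.IsMaximal := Ideal.IsPrime.isMaximal ‹_› hp
  have hQ0 : Q i ≠ ⊥ := Ideal.ne_bot_of_liesOver_of_ne_bot hp _
  have hQm : (Q i).IsMaximal := Ideal.IsPrime.isMaximal inferInstance hQ0
  have : Fintype (p.primesOver (𝓞 L)) := (Algebra.QuasiFinite.finite_primesOver p).fintype
  have hsum := Ideal.sum_ramification_inertia_eq_finrank p (𝓞 L)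
  rw [← IsFractionRing.finrank_eq (𝓞 K) K (𝓞 L) L, hKL] at hsum
  set g : p.primesOver (𝓞 L) → ℕ := fun q ↦ q.1.ramificationIdx (𝓞 K) * q.1.inertiaDeg (𝓞 K)
  let e : Fin 3 → p.primesOver (𝓞 L) := fun j ↦ ⟨Q j, inferInstance, inferInstance⟩
  have he : Function.Injective e := fun a b h ↦ hQ (congrArg Subtype.val h)
  have hpos : ∀ q, 0 < g q := fun q ↦ by
    have := q.2.1
    exact Nat.mul_pos (Ideal.ramificationIdx_pos _ _) (Ideal.inertiaDeg_pos _ _)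
  have hle : ∑ j, g (e j) ≤ 3 := by
    refine le_of_le_of_eq ?_ hsum
    rw [show ∑ j, g (e j) = ∑ q ∈ Finset.univ.map ⟨e, he⟩, g q from
      (Finset.sum_map Finset.univ ⟨e, he⟩ g).symm]
    exact Finset.sum_le_sum_of_subset (Finset.subset_univ _)
  have hgi : g (e i) = 1 := by
    rw [Fin.sum_univ_three] at hle
    have h0 := hpos (e 0)
    have h1 := hpos (e 1)
    have h2 := hpos (e 2)
    fin_cases i <;> simp <;> omega
  obtain ⟨h1, h2⟩ := mul_eq_one.1 hgi
  refine ⟨?_, ?_⟩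
  · rw [Ideal.ramificationIdx'_eq_ramificationIdx p (Q i) hp]
    exact h1
  · rw [Ideal.inertiaDeg_eq_of_isMaximal p] at h2
    let : Field (𝓞 K ⧸ p) := Ideal.Quotient.field p
    intro x
    have hb := Subalgebra.bot_eq_top_of_finrank_eq_one h2
    have hx : Ideal.Quotient.mk (Q i) x ∈ (⊥ : Subalgebra (𝓞 K ⧸ p) (𝓞 L ⧸ Q i)) :=
      hb ▸ Algebra.mem_top
    obtain ⟨b, hb⟩ := Algebra.mem_bot.1 hx
    obtain ⟨a, rfl⟩ := Ideal.Quotient.mk_surjective b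
    exact ⟨a, Ideal.Quotient.eq.1 hb.symm⟩

/-- A product of linear factors permuted by the Galois group is defined over the base field. -/
theorem prod_X_add_C_lifts {k L ι : Type*} [Field k] [Field L] [Algebra k L] [Fintype ι]
    [FiniteDimensional k L] [IsGalois k L] (φ : ι → L)
    (hφ : ∀ σ : L ≃ₐ[k] L, ∃ π : Equiv.Perm ι, ∀ i, σ (φ i) = φ (π i)) :
    ∃ P : Polynomial k, P.map (algebraMap k L) = ∏ i, (Polynomial.X + Polynomial.C (φ i)) := by
  rw [← Polynomial.mem_lifts, Polynomial.lifts_iff_coeff_lifts]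
  intro n
  rw [IsGalois.mem_range_algebraMap_iff_fixed]
  intro σ
  obtain ⟨π, hπ⟩ := hφ σ
  have h : (∏ i, (Polynomial.X + Polynomial.C (φ i))).map (σ : L →+* L)
      = ∏ i, (Polynomial.X + Polynomial.C (φ i)) := by
    simp only [Polynomial.map_prod, Polynomial.map_add, Polynomial.map_X, Polynomial.map_C]
    rw [← Equiv.prod_comp π fun i ↦ Polynomial.X + Polynomial.C (φ i)]
    exact Finset.prod_congr rfl fun i _ ↦ by simp [hπ]
  conv_rhs => rw [← h]
  rw [Polynomial.coeff_map]
  rfl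

/-- A root `x` of `∏ i, (X + φᵢ)` gives the point `(x, 0, 1, 0)`. -/
theorem BSDHasPoint_of_aeval_eq_zero {k L F : Type*} [Field k] [Field L] [Algebra k L]
    [Field F] [Algebra k F] (φ ψ : Fin 3 → L) (d θ θb : L) (P : Polynomial k)
    (hP : P.map (algebraMap k L) = ∏ i, (Polynomial.X + Polynomial.C (φ i)))
    (x : F) (hx : P.aeval x = 0) : BSDHasPoint k φ ψ d θ θb F := by
  refine ⟨x, 0, 1, 0, by simp, ?_⟩
  simp only [BSDEqn, TensorProduct.tmul_zero, add_zero, zero_mul]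
  let l : L →ₐ[k] L ⊗[k] F := Algebra.TensorProduct.includeLeft
  let r : F →ₐ[k] L ⊗[k] F := Algebra.TensorProduct.includeRight
  have h1 : P.aeval (r x) = 0 := by rw [Polynomial.aeval_algHom_apply, hx, map_zero]
  have h2 : P.aeval (r x) = (P.map (algebraMap k L)).eval₂ (l : L →+* L ⊗[k] F) (r x) := by
    rw [Polynomial.eval₂_map, Polynomial.aeval_def]
    congr 1
  rw [h1, hP, Polynomial.eval₂_finsetProd] at h2
  rw [h2]
  exact Finset.prod_congr rfl fun i _ ↦ by simp [l, r]

/-- if `𝔓` is a prime of `𝓞 K` dividing `d 𝓞 K` that splits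
completely in `L`, then `X` has a `K_𝔓`-point. -/
theorem bsd_local_point_split_prime
    -- `k` is a number field and `L/k` a Galois extension with `Gal(L/k) ≃ S₃`
    (k K L : Type*) [Field k] [NumberField k] [Field K] [NumberField K]
    [Field L] [NumberField L]
    [Algebra k K] [Algebra k L] [Algebra K L] [IsScalarTower k K L]
    [IsGalois k L]
    (hGalS3 : Nonempty ((L ≃ₐ[k] L) ≃* Equiv.Perm (Fin 3)))
    -- `K` is the (unique) quadratic extension of `k` contained in `L`
    (hK2 : Module.finrank k K = 2)
    -- `φ = φ₀, φ₁, φ₂` and `ψ = ψ₀, ψ₁, ψ₂` are families of elements of `𝓞 L`,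
    -- permuted compatibly by `Gal(L/k)` (Galois conjugates over `k`)
    (φ ψ : Fin 3 → (𝓞 L)) (φL ψL : Fin 3 → L)
    (hφL : ∀ i, φL i = algebraMap (𝓞 L) L (φ i))
    (hψL : ∀ i, ψL i = algebraMap (𝓞 L) L (ψ i))
    (hconj : ∀ σ : L ≃ₐ[k] L, ∃ π : Equiv.Perm (Fin 3),
        ∀ i, σ (φL i) = φL (π i) ∧ σ (ψL i) = ψL (π i))
    -- `(1, φ, ψ)` is a `k`-basis of a cubic extension `K₀` of `k` contained in `L`
    (K₀ : IntermediateField k L) (hK₀3 : Module.finrank k K₀ = 3)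
    (hbasis : Submodule.span k ({1, φL 0, ψL 0} : Set L)
        = Subalgebra.toSubmodule K₀.toSubalgebra)
    -- `θ ∈ 𝓞 K`, with Galois conjugate `θ̄` over `k`
    (θ θb : 𝓞 K) (θL θbL : L)
    (hθL : θL = algebraMap K L (algebraMap (𝓞 K) K θ))
    (hθbL : θbL = algebraMap K L (algebraMap (𝓞 K) K θb))
    (hθconj : ∃ σ : L ≃ₐ[k] L, σ θL = θbL)
    -- `d ∈ 𝓞 k` is nonzero
    (d : 𝓞 k) (hd : d ≠ 0)
    (dL : L) (hdL : dL = algebraMap k L (algebraMap (𝓞 k) k d))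
    -- a prime `𝔓` of `𝓞 K` dividing `d 𝓞 K` that splits completely in `L`
    (𝔓 : HeightOneSpectrum (𝓞 K))
    (hdvd : algebraMap (𝓞 k) (𝓞 K) d ∈ 𝔓.asIdeal)
    (Q₁ Q₂ Q₃ : Ideal (𝓞 L))
    (hQ₁ : Q₁.IsPrime) (hQ₂ : Q₂.IsPrime) (hQ₃ : Q₃.IsPrime)
    (hQ₁0 : Q₁ ≠ ⊥) (hQ₂0 : Q₂ ≠ ⊥) (hQ₃0 : Q₃ ≠ ⊥)
    (hQ12 : Q₁ ≠ Q₂) (hQ13 : Q₁ ≠ Q₃) (hQ23 : Q₂ ≠ Q₃)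
    (hsplit : Ideal.map (algebraMap (𝓞 K) (𝓞 L)) 𝔓.asIdeal = Q₁ * Q₂ * Q₃) :
    BSDHasPoint K φL ψL dL θL θbL (𝔓.adicCompletion K) := by
  have : FiniteDimensional k L := Module.Finite.of_restrictScalars_finite ℚ k L
  have hkL : Module.finrank k L = 6 := by
    rw [← IsGalois.card_aut_eq_finrank, Nat.card_congr hGalS3.some.toEquiv,
      Nat.card_eq_fintype_card, Fintype.card_perm]
    rfl
  have hKL : Module.finrank K L = 3 := by
    have := Module.finrank_mul_finrank k K L
    rw [hK2, hkL] at this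
    omega
  have hover : ∀ i, (![Q₁, Q₂, Q₃] i).IsPrime ∧
      Ideal.map (algebraMap (𝓞 K) (𝓞 L)) 𝔓.asIdeal ≤ ![Q₁, Q₂, Q₃] i := by
    rw [hsplit]
    intro i
    fin_cases i
    · exact ⟨hQ₁, Ideal.mul_le_left.trans Ideal.mul_le_left⟩
    · exact ⟨hQ₂, Ideal.mul_le_left.trans Ideal.mul_le_right⟩
    · exact ⟨hQ₃, Ideal.mul_le_right⟩
  have hprime : ∀ i, (![Q₁, Q₂, Q₃] i).IsPrime := fun i ↦ (hover i).1
  have hlies : ∀ i, (![Q₁, Q₂, Q₃] i).LiesOver 𝔓.asIdeal := fun i ↦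
    ⟨𝔓.isMaximal.eq_of_le (Ideal.comap_ne_top _ (hprime i).ne_top)
      (Ideal.map_le_iff_le_comap.1 (hover i).2)⟩
  have hinj : Function.Injective ![Q₁, Q₂, Q₃] := by
    intro i j h
    fin_cases i <;> fin_cases j <;> simp_all
  obtain ⟨he, hf⟩ := ramificationIdx'_eq_one_and_exists_sub_mem hKL 𝔓.asIdeal 𝔓.ne_bot ![Q₁, Q₂, Q₃] hinj 0
  let w : HeightOneSpectrum (𝓞 L) := ⟨Q₁, hQ₁, hQ₁0⟩
  have : w.asIdeal.LiesOver 𝔓.asIdeal := hlies 0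
  obtain ⟨P, hP⟩ := prod_X_add_C_lifts (k := k) φL fun σ ↦
    (hconj σ).imp fun π hπ i ↦ (hπ i).1
  have hPK : (P.map (algebraMap k K)).map (algebraMap K L)
      = ∏ i, (Polynomial.X + Polynomial.C (φL i)) := by
    rw [Polynomial.map_map, ← IsScalarTower.algebraMap_eq, hP]
  obtain ⟨y, hy⟩ := exists_root_adicCompletion 𝔓 w he hf (P.map (algebraMap k K))
    (∏ i, (Polynomial.X + Polynomial.C (φ i)))
    (by rw [hPK]; simp [Polynomial.map_prod, hφL]) (-φ 0)
    (by simp [Polynomial.IsRoot, Fin.prod_univ_three])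
  exact BSDHasPoint_of_aeval_eq_zero φL ψL dL θL θbL _ hPK y hy
end

section
/- Let φ be the real root of t³ = t + 1 and K₀ = ℚ(φ). The cubic surface X_BSD ⊂ P³_ℚ defined by 2·N_{K₀/ℚ}(x + φz + φ²w) = (x − y)(x² + xy + 6y²) (equivalently, 2·∏_{i=0}^{2}(x + φ_i z + φ_i² w) = (x − y)(x + θ'y)(x + θ̄'y) with θ' = (1 + √−23)/2, where φ₀, φ₁, φ₂ are the roots of t³ − t − 1) fails the Hasse principle: it has a nontrivial solution over ℝ and over ℚ_p for every prime p, but no nontrivial solution over ℚ. -/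
/-- The norm form of `x + φ z + φ² w`, where `φ³ = φ + 1`. -/
def cubicNormForm {R : Type*} [CommRing R] (x z w : R) : R :=
  x ^ 3 + 2 * x ^ 2 * w - x * z ^ 2 + x * w ^ 2 - 3 * x * z * w + z ^ 3 + w ^ 3 - z * w ^ 2

/-- Relations between two of the roots of `t³ - t - 1` make the norm form split. -/
theorem prod_eq_cubicNormForm {R : Type*} [CommRing R] (a b x z w : R)
    (h : a ^ 2 + a * b + b ^ 2 = 1) (h' : a ^ 2 * b + a * b ^ 2 = -1) :
    (x + a * z + a ^ 2 * w) * (x + b * z + b ^ 2 * w) * (x + (-a - b) * z + (-a - b) ^ 2 * w)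
      = cubicNormForm x z w := by
  unfold cubicNormForm
  grind

theorem aeval_eq_cubicNormForm
    (φc : Fin 3 → ℂ) (hφc : ∀ i, (φc i) ^ 3 = φc i + 1) (hφinj : Function.Injective φc)
    (N : MvPolynomial (Fin 3) ℚ)
    (hN : ∀ x z w : ℂ, MvPolynomial.aeval ![x, z, w] N
        = ∏ i : Fin 3, (x + φc i * z + (φc i) ^ 2 * w))
    {A : Type*} [CommRing A] [Algebra ℚ A] (x z w : A) :
    MvPolynomial.aeval ![x, z, w] N = cubicNormForm x z w := by
  have h01 : φc 0 - φc 1 ≠ 0 := sub_ne_zero.2 (hφinj.ne (by decide))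
  have h02 : φc 0 - φc 2 ≠ 0 := sub_ne_zero.2 (hφinj.ne (by decide))
  have h12 : φc 1 - φc 2 ≠ 0 := sub_ne_zero.2 (hφinj.ne (by decide))
  have h0 := hφc 0
  have h1 := hφc 1
  have h2 := hφc 2
  set a := φc 0
  set b := φc 1
  set c := φc 2
  have q1 : a ^ 2 + a * b + b ^ 2 = 1 :=
    mul_left_cancel₀ h01 (by linear_combination h0 - h1)
  have q2 : a ^ 2 + a * c + c ^ 2 = 1 :=
    mul_left_cancel₀ h02 (by linear_combination h0 - h2)
  have hc : c = -a - b :=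
    mul_left_cancel₀ h12 (by linear_combination q1 - q2)
  have q3 : a ^ 2 * b + a * b ^ 2 = -1 := by linear_combination a * q1 - h0
  let P : MvPolynomial (Fin 3) ℚ :=
    cubicNormForm (MvPolynomial.X 0) (MvPolynomial.X 1) (MvPolynomial.X 2)
  have hNP : N = P := by
    apply MvPolynomial.map_injective (algebraMap ℚ ℂ) (algebraMap ℚ ℂ).injective
    apply MvPolynomial.funext
    intro v
    have hv : v = ![v 0, v 1, v 2] := by
      ext i; fin_cases i <;> rfl
    have := hN (v 0) (v 1) (v 2)
    rw [← hv, MvPolynomial.aeval_def, ← MvPolynomial.eval_map] at this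
    rw [this, Fin.prod_univ_three]
    change (_ + a * _ + a ^ 2 * _) * (_ + b * _ + b ^ 2 * _) * (_ + c * _ + c ^ 2 * _) = _
    rw [hc, prod_eq_cubicNormForm _ _ _ _ _ q1 q3]
    simp [P, cubicNormForm]
  rw [hNP]
  simp [P, cubicNormForm]

theorem PadicInt.exists_root_of_cubic {p : ℕ} [Fact p.Prime] (c₀ c₁ c₂ c₃ : ℤ_[p]) (t : ZMod p)
    (h : toZMod c₃ * t ^ 3 + toZMod c₂ * t ^ 2 + toZMod c₁ * t + toZMod c₀ = 0)
    (h' : 3 * toZMod c₃ * t ^ 2 + 2 * toZMod c₂ * t + toZMod c₁ ≠ 0) :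
    ∃ s : ℤ_[p], c₃ * s ^ 3 + c₂ * s ^ 2 + c₁ * s + c₀ = 0 ∧ toZMod s = t := by
  have hlt : ∀ z : ℤ_[p], ‖z‖ < 1 ↔ toZMod z = 0 := fun z => by
    rw [← RingHom.mem_ker, ker_toZMod, IsLocalRing.mem_maximalIdeal, mem_nonunits]
  obtain ⟨t, rfl⟩ := ZMod.ringHom_surjective (toZMod (p := p)) t
  open Polynomial in
  let F : ℤ_[p][X] := C c₃ * X ^ 3 + C c₂ * X ^ 2 + C c₁ * X + C c₀
  have hF : ∀ s, F.aeval s = c₃ * s ^ 3 + c₂ * s ^ 2 + c₁ * s + c₀ := fun s => by simp [F]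
  have hF' : F.derivative.aeval t = 3 * c₃ * t ^ 2 + 2 * c₂ * t + c₁ := by
    simp [F]; ring
  have h1 : ‖F.derivative.aeval t‖ = 1 := by
    refine le_antisymm (norm_le_one _) (not_lt.1 fun hl => h' ?_)
    rw [hlt, hF'] at hl
    simpa only [map_add, map_mul, map_pow, map_ofNat] using hl
  have h2 : ‖F.aeval t‖ < 1 := by
    rw [hlt, hF]
    simpa using h
  obtain ⟨s, hs, hst, -⟩ := hensels_lemma (F := F) (a := t) (by rw [h1]; simpa using h2)
  refine ⟨s, by rw [← hF, hs], ?_⟩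
  rw [h1, hlt, map_sub, sub_eq_zero] at hst
  exact hst

/-- If `t³ - t - 1` has no root in a field, then the norm form is anisotropic. -/
theorem eq_zero_of_cubicNormForm_eq_zero {F : Type*} [Field F] (hF : ∀ r : F, r ^ 3 ≠ r + 1)
    {x z w : F} (h : cubicNormForm x z w = 0) : x = 0 ∧ z = 0 ∧ w = 0 := by
  unfold cubicNormForm at h
  by_cases hw : w = 0
  · subst hw
    by_cases hz : z = 0
    · subst hz
      simpa using h
    · refine absurd ?_ (hF (-x / z))
      field_simp
      linear_combination -h
  · exfalso
    by_cases hα : z ^ 2 - x * w - w ^ 2 = 0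
    · have hβ : w * (x * z - w ^ 2) ^ 2 = 0 := by
        linear_combination w ^ 2 * h + (z * (x * z - w ^ 2) - x * (z ^ 2 - x * w - w ^ 2)) * hα
      have hβ' : x * z - w ^ 2 = 0 := by
        simpa [hw] using hβ
      apply hF (z / w)
      field_simp
      linear_combination z * hα + w * hβ'
    · apply hF (-(x * z - w ^ 2) / (z ^ 2 - x * w - w ^ 2))
      field_simp
      linear_combination (-w * (x * z - w ^ 2) - z * (z ^ 2 - x * w - w ^ 2)) * h

/-- Away from small characteristics, a zero of the cubic form at which the norm form does not
vanish is a smooth point of the surface. -/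
theorem not_singular {F : Type*} [Field F] (h2 : (2 : F) ≠ 0) (h3 : (3 : F) ≠ 0)
    (h19 : (19 : F) ≠ 0) (h23 : (23 : F) ≠ 0) {x y z w : F} (hN : cubicNormForm x z w ≠ 0)
    (h : 2 * cubicNormForm x z w = x ^ 3 + 5 * x * y ^ 2 - 6 * y ^ 3)
    (hy : 10 * x * y - 18 * y ^ 2 = 0)
    (hz : -2 * x * z - 3 * x * w + 3 * z ^ 2 - w ^ 2 = 0)
    (hw : 2 * x ^ 2 + 2 * x * w - 3 * x * z + 3 * w ^ 2 - 2 * z * w = 0) : False := by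
  have hw0 : w = 0 := by
    have : (2 * cubicNormForm x z w) * w = 0 := by
      unfold cubicNormForm
      linear_combination (w ^ 2 - x * z) * hz + (w ^ 2 - z ^ 2 + x * w) * hw
    exact (mul_eq_zero.1 this).resolve_left (mul_ne_zero h2 hN)
  have hz0 : 3 * z - 2 * x = 0 := by
    have : cubicNormForm x z w * (3 * z - 2 * x) = 0 := by
      unfold cubicNormForm
      linear_combination (z ^ 2 - x * w - x * z) * hz + (z * w - x * w - x ^ 2) * hw
    exact (mul_eq_zero.1 this).resolve_left hN
  subst hw0
  have hx : x ≠ 0 := by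
    rintro rfl
    simp only [mul_zero, sub_zero, mul_eq_zero, h3, false_or] at hz0
    simp [cubicNormForm, hz0] at hN
  have hN27 : 27 * cubicNormForm x z 0 = 23 * x ^ 3 := by
    have hz' : z = 2 / 3 * x := by field_simp; linear_combination hz0
    rw [hz']
    unfold cubicNormForm
    field_simp
    ring
  have hy' : 2 * (y * (5 * x - 9 * y)) = 0 := by linear_combination hy
  rcases mul_eq_zero.1 ((mul_eq_zero.1 hy').resolve_left h2) with hy0 | hy0
  · subst hy0
    have : 19 * x ^ 3 = 0 := by linear_combination 27 * h - 2 * hN27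
    simp [h19, hx] at this
  · have : 2 * 23 * x ^ 3 = 0 := by
      linear_combination 243 * h - 18 * hN27 - (25 * x ^ 2 + 45 * x * y - 162 * y ^ 2) * hy0
    simp [h2, h23, hx] at this

theorem exists_zmod_point (p : ℕ) [Fact p.Prime] : ∃ x y z w : ZMod p,
    ¬(x = 0 ∧ y = 0 ∧ z = 0 ∧ w = 0) ∧
      2 * cubicNormForm x z w = x ^ 3 + 5 * x * y ^ 2 - 6 * y ^ 3 := by
  classical
  open MvPolynomial in
  let f : MvPolynomial (Fin 4) (ZMod p) :=
    2 * cubicNormForm (X 0) (X 2) (X 3) - (X 0 ^ 3 + 5 * X 0 * X 1 ^ 2 - 6 * X 1 ^ 3)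
  have hf : ∀ v : Fin 4 → ZMod p, MvPolynomial.eval v f = 2 * cubicNormForm (v 0) (v 2) (v 3)
      - (v 0 ^ 3 + 5 * v 0 * v 1 ^ 2 - 6 * v 1 ^ 3) := fun v => by
    simp [f, cubicNormForm]
  have hhom : f.IsHomogeneous 3 := by
    have hX := MvPolynomial.isHomogeneous_X (R := ZMod p) (σ := Fin 4)
    have hC (n : ℕ) [n.AtLeastTwo] :
        (OfNat.ofNat n : MvPolynomial (Fin 4) (ZMod p)).IsHomogeneous 0 := by
      rw [← map_ofNat (MvPolynomial.C : ZMod p →+* MvPolynomial (Fin 4) (ZMod p)) n]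
      exact MvPolynomial.isHomogeneous_C _ _
    have hN : (cubicNormForm (.X 0) (.X 2) (.X 3) :
        MvPolynomial (Fin 4) (ZMod p)).IsHomogeneous 3 :=
      (((((((((hX 0).pow 3).add (((hC 2).mul ((hX 0).pow 2)).mul (hX 3))).sub
        ((hX 0).mul ((hX 2).pow 2))).add ((hX 0).mul ((hX 3).pow 2))).sub
        ((((hC 3).mul (hX 0)).mul (hX 2)).mul (hX 3))).add ((hX 2).pow 3)).add
        ((hX 3).pow 3)).sub ((hX 2).mul ((hX 3).pow 2)))
    exact ((hC 2).mul hN).sub ((((hX 0).pow 3).add (((hC 5).mul (hX 0)).mul ((hX 1).pow 2))).sub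
      ((hC 6).mul ((hX 1).pow 3)))
  have hdvd := char_dvd_card_solutions p (f := f)
    (lt_of_le_of_lt hhom.totalDegree_le (by simp))
  have h0 : MvPolynomial.eval (0 : Fin 4 → ZMod p) f = 0 := by
    rw [hf]; simp [cubicNormForm]
  have hcard : 1 < Fintype.card { v : Fin 4 → ZMod p // MvPolynomial.eval v f = 0 } :=
    lt_of_lt_of_le (Fact.out : p.Prime).one_lt
      (Nat.le_of_dvd (Fintype.card_pos_iff.2 ⟨⟨0, h0⟩⟩) hdvd)
  obtain ⟨⟨v, hv⟩, hne⟩ := Fintype.exists_ne_of_one_lt_card hcard ⟨0, h0⟩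
  refine ⟨v 0, v 1, v 2, v 3, fun h => hne ?_, sub_eq_zero.1 ((hf v).symm.trans hv)⟩
  ext i
  fin_cases i
  · exact h.1
  · exact h.2.1
  · exact h.2.2.1
  · exact h.2.2.2

theorem exists_padicInt_point_of_root {p : ℕ} [Fact p.Prime] (r : ℤ_[p]) (hr : r ^ 3 = r + 1) :
    ∃ x y z w : ℤ_[p], ¬(x = 0 ∧ y = 0 ∧ z = 0 ∧ w = 0) ∧
      2 * cubicNormForm x z w = x ^ 3 + 5 * x * y ^ 2 - 6 * y ^ 3 := by
  refine ⟨0, 0, -r, 1, by simp, ?_⟩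
  unfold cubicNormForm
  linear_combination -2 * hr

theorem exists_padicInt_point_of_no_root {p : ℕ} [Fact p.Prime] (h2 : (2 : ZMod p) ≠ 0)
    (h3 : (3 : ZMod p) ≠ 0) (h19 : (19 : ZMod p) ≠ 0) (h23 : (23 : ZMod p) ≠ 0)
    (hp : ∀ r : ZMod p, r ^ 3 ≠ r + 1) :
    ∃ x y z w : ℤ_[p], ¬(x = 0 ∧ y = 0 ∧ z = 0 ∧ w = 0) ∧
      2 * cubicNormForm x z w = x ^ 3 + 5 * x * y ^ 2 - 6 * y ^ 3 := by
  obtain ⟨x, y, z, w, hne, h⟩ := exists_zmod_point p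
  have hN : cubicNormForm x z w ≠ 0 := by
    intro h0
    obtain ⟨rfl, rfl, rfl⟩ := eq_zero_of_cubicNormForm_eq_zero hp h0
    rw [h0] at h
    have : 2 * 3 * y ^ 3 = 0 := by linear_combination h
    simp [h2, h3] at this
    exact hne ⟨rfl, this, rfl, rfl⟩
  obtain ⟨x, rfl⟩ := ZMod.ringHom_surjective (PadicInt.toZMod (p := p)) x
  obtain ⟨y, rfl⟩ := ZMod.ringHom_surjective (PadicInt.toZMod (p := p)) y
  obtain ⟨z, rfl⟩ := ZMod.ringHom_surjective (PadicInt.toZMod (p := p)) z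
  obtain ⟨w, rfl⟩ := ZMod.ringHom_surjective (PadicInt.toZMod (p := p)) w
  have lift_ne : ∀ x' y' z' w' : ℤ_[p], PadicInt.toZMod x' = PadicInt.toZMod x →
      PadicInt.toZMod y' = PadicInt.toZMod y → PadicInt.toZMod z' = PadicInt.toZMod z →
      PadicInt.toZMod w' = PadicInt.toZMod w → ¬(x' = 0 ∧ y' = 0 ∧ z' = 0 ∧ w' = 0) := by
    rintro _ _ _ _ hx hy hz hw ⟨rfl, rfl, rfl, rfl⟩
    rw [map_zero] at hx hy hz hw
    exact hne ⟨hx.symm, hy.symm, hz.symm, hw.symm⟩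
  have h' := h
  unfold cubicNormForm at h'
  by_cases hy : 10 * PadicInt.toZMod x * PadicInt.toZMod y - 18 * PadicInt.toZMod y ^ 2 = 0
  · by_cases hz : -2 * PadicInt.toZMod x * PadicInt.toZMod z
        - 3 * PadicInt.toZMod x * PadicInt.toZMod w + 3 * PadicInt.toZMod z ^ 2
        - PadicInt.toZMod w ^ 2 = 0
    · by_cases hw : 2 * PadicInt.toZMod x ^ 2 + 2 * PadicInt.toZMod x * PadicInt.toZMod w
          - 3 * PadicInt.toZMod x * PadicInt.toZMod z + 3 * PadicInt.toZMod w ^ 2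
          - 2 * PadicInt.toZMod z * PadicInt.toZMod w = 0
      · exact (not_singular h2 h3 h19 h23 hN h hy hz hw).elim
      · obtain ⟨s, hs, hst⟩ := PadicInt.exists_root_of_cubic
          (2 * (x ^ 3 - x * z ^ 2 + z ^ 3) - (x ^ 3 + 5 * x * y ^ 2 - 6 * y ^ 3))
          (2 * (2 * x ^ 2 - 3 * x * z)) (2 * (x - z)) 2 (PadicInt.toZMod w)
          (by simp only [map_add, map_sub, map_mul, map_pow, map_ofNat]; linear_combination h')
          (by
            simp only [map_sub, map_mul, map_pow, map_ofNat]
            intro h0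
            exact hw (mul_left_cancel₀ h2 (by linear_combination h0)))
        refine ⟨x, y, z, s, lift_ne _ _ _ _ rfl rfl rfl hst, ?_⟩
        unfold cubicNormForm
        linear_combination hs
    · obtain ⟨s, hs, hst⟩ := PadicInt.exists_root_of_cubic
        (2 * (x ^ 3 + 2 * x ^ 2 * w + x * w ^ 2 + w ^ 3) - (x ^ 3 + 5 * x * y ^ 2 - 6 * y ^ 3))
        (2 * (-3 * x * w - w ^ 2)) (2 * (-x)) 2 (PadicInt.toZMod z)
        (by simp only [map_add, map_sub, map_mul, map_pow, map_neg, map_ofNat]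
            linear_combination h')
        (by
          simp only [map_sub, map_mul, map_pow, map_neg, map_ofNat]
          intro h0
          exact hz (mul_left_cancel₀ h2 (by linear_combination h0)))
      refine ⟨x, y, s, w, lift_ne _ _ _ _ rfl rfl hst rfl, ?_⟩
      unfold cubicNormForm
      linear_combination hs
  · obtain ⟨s, hs, hst⟩ := PadicInt.exists_root_of_cubic
      (2 * cubicNormForm x z w - x ^ 3) 0 (-5 * x) 6 (PadicInt.toZMod y)
      (by simp only [cubicNormForm, map_add, map_sub, map_mul, map_pow, map_neg, map_zero,
            map_ofNat]
          linear_combination h')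
      (by
        simp only [map_mul, map_neg, map_zero, map_ofNat]
        exact fun h0 => hy (by linear_combination -h0))
    exact ⟨x, s, z, w, lift_ne _ _ _ _ rfl hst rfl rfl, by linear_combination hs⟩

theorem exists_padicInt_point (p : ℕ) [Fact p.Prime] :
    ∃ x y z w : ℤ_[p], ¬(x = 0 ∧ y = 0 ∧ z = 0 ∧ w = 0) ∧
      2 * cubicNormForm x z w = x ^ 3 + 5 * x * y ^ 2 - 6 * y ^ 3 := by
  have hne : ∀ q : ℕ, q.Prime → p ≠ q → ((q : ℕ) : ZMod p) ≠ 0 := fun q hq hpq h =>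
    hpq ((Nat.prime_dvd_prime_iff_eq Fact.out hq).1 ((ZMod.natCast_eq_zero_iff _ _).1 h))
  by_cases h2 : p = 2
  · subst h2
    obtain ⟨s, hs, -⟩ := PadicInt.exists_root_of_cubic (p := 2) 3 (-5) 0 4 1
      (by simp only [map_neg, map_zero, map_ofNat]; reduce_mod_char)
      (by simp only [map_neg, map_zero, map_ofNat]; reduce_mod_char; exact one_ne_zero)
    refine ⟨2 * s, 1, 0, 0, by simp, ?_⟩
    unfold cubicNormForm
    linear_combination 2 * hs
  by_cases h3 : p = 3
  · subst h3
    obtain ⟨s, hs, -⟩ := PadicInt.exists_root_of_cubic (p := 3) 1 0 (-2) 2 2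
      (by simp only [map_neg, map_zero, map_ofNat, map_one]; reduce_mod_char)
      (by simp only [map_neg, map_zero, map_ofNat]; reduce_mod_char; exact one_ne_zero)
    refine ⟨1, 0, s, 0, by simp, ?_⟩
    unfold cubicNormForm
    linear_combination hs
  by_cases h23 : p = 23
  · subst h23
    obtain ⟨s, hs, -⟩ := PadicInt.exists_root_of_cubic (p := 23) (-1) (-1) 0 1 3
      (by simp only [map_neg, map_zero, map_one]; reduce_mod_char)
      (by
        simp only [map_neg, map_zero, map_one]
        reduce_mod_char
        exact_mod_cast hne 3 (by norm_num) (by norm_num))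
    exact exists_padicInt_point_of_root s (by linear_combination hs)
  have h23' : (23 : ZMod p) ≠ 0 := by exact_mod_cast hne 23 (by norm_num) h23
  by_cases hr : ∃ r : ZMod p, r ^ 3 = r + 1
  · obtain ⟨r, hr⟩ := hr
    obtain ⟨s, hs, -⟩ := PadicInt.exists_root_of_cubic (p := p) (-1) (-1) 0 1 r
      (by simp only [map_neg, map_zero, map_one]; linear_combination hr)
      (by
        simp only [map_neg, map_zero, map_one]
        intro h0
        apply h23'
        linear_combination (4 - 3 * (2 * r - 3) * r) * h0 + 9 * (2 * r - 3) * hr)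
    exact exists_padicInt_point_of_root s (by linear_combination hs)
  · push Not at hr
    have h19 : p ≠ 19 := by
      rintro rfl
      exact hr 6 (by reduce_mod_char)
    refine exists_padicInt_point_of_no_root ?_ ?_ ?_ h23' hr
    · exact_mod_cast hne 2 (by norm_num) h2
    · exact_mod_cast hne 3 (by norm_num) h3
    · exact_mod_cast hne 19 (by norm_num) h19

theorem exists_eq_mul_isCoprime_dvd_pow {R : Type*} [CommRing R] [IsDomain R]
    [IsPrincipalIdealRing R] (A : R) {s : R} (hs : s ≠ 0) :
    ∃ (u v : R) (n : ℕ), s = u * v ∧ IsCoprime v A ∧ u ∣ A ^ n := by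
  induction s using WfDvdMonoid.induction_on_irreducible with
  | zero => exact (hs rfl).elim
  | unit s h => exact ⟨1, s, 0, (one_mul s).symm,
      isCoprime_one_left.of_isCoprime_of_dvd_left h.dvd, one_dvd _⟩
  | mul a p ha hp ih =>
    obtain ⟨u, v, n, rfl, hv, hu⟩ := ih ha
    rcases hp.isCoprime_or_dvd A with h | h
    · exact ⟨u, p * v, n, by ring, h.mul_left hv, hu⟩
    · exact ⟨p * u, v, n + 1, by ring, hv, by rw [pow_succ']; exact mul_dvd_mul h hu⟩

section Quadratic

variable {R : Type*} [CommRing R] {θ : R}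

theorem intCast_add_mul_eq_zero [CharZero R] (hθ : θ ^ 2 - θ + 6 = 0) {r s : ℤ}
    (h : (r : R) + s * θ = 0) : r = 0 ∧ s = 0 := by
  have h0 : ((r ^ 2 + r * s + 6 * s ^ 2 : ℤ) : R) = 0 := by
    push_cast
    linear_combination (r + s * (1 - θ)) * h + (s : R) ^ 2 * hθ
  have h1 := Int.cast_eq_zero.1 h0
  have hs : s = 0 := by
    by_contra hs
    have : 0 < s ^ 2 := by positivity
    nlinarith [sq_nonneg (2 * r + s)]
  subst hs
  simpa using h1

theorem intCast_add_mul_inj [CharZero R] (hθ : θ ^ 2 - θ + 6 = 0) {r s r' s' : ℤ}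
    (h : (r : R) + s * θ = r' + s' * θ) : r = r' ∧ s = s' := by
  have := intCast_add_mul_eq_zero hθ (r := r - r') (s := s - s')
    (by push_cast; linear_combination h)
  exact ⟨sub_eq_zero.1 this.1, sub_eq_zero.1 this.2⟩

theorem exists_pow_eq_intCast_add_mul (hθ : θ ^ 2 - θ + 6 = 0) (x y : ℤ) (k : ℕ) :
    ∃ X Y : ℤ, ((x : R) + y * θ) ^ k = X + Y * θ ∧ X ≡ x ^ k [ZMOD 2] ∧
      X + Y ≡ (x + y) ^ k [ZMOD 2] := by
  induction k with
  | zero => exact ⟨1, 0, by simp, by simp, by simp⟩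
  | succ k ih =>
    obtain ⟨X, Y, h, hX, hXY⟩ := ih
    refine ⟨X * x - 6 * (Y * y), X * y + Y * x + Y * y, ?_, ?_, ?_⟩
    · rw [pow_succ, h]
      push_cast
      linear_combination (Y * y : R) * hθ
    · rw [pow_succ]
      refine Int.ModEq.trans ?_ (hX.mul_right x)
      exact (Int.modEq_iff_dvd.2 ⟨3 * (Y * y), by ring⟩)
    · rw [pow_succ]
      refine Int.ModEq.trans ?_ (hXY.mul_right (x + y))
      exact (Int.modEq_iff_dvd.2 ⟨3 * (Y * y), by ring⟩)

theorem even_of_two_dvd_pow [IsDomain R] [CharZero R] (hθ : θ ^ 2 - θ + 6 = 0)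
    {σ : R →+* R} (hσθ : σ θ = θ)
    (hfix : ∀ x, σ x = x → ∃ r s : ℤ, x = r + s * θ) {x y : ℤ} {k : ℕ}
    (h : 2 ∣ ((x : R) + y * θ) ^ k) : 2 ∣ x ∧ 2 ∣ y := by
  obtain ⟨X, Y, hk, hX, hXY⟩ := exists_pow_eq_intCast_add_mul hθ x y k
  obtain ⟨μ, hμ⟩ := h
  rw [hk] at hμ
  obtain ⟨r, s, rfl⟩ := hfix μ (by
    refine mul_left_cancel₀ (two_ne_zero (α := R)) ?_
    rw [← hμ]
    simpa [hσθ, map_ofNat] using (congrArg σ hμ).symm)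
  obtain ⟨rfl, rfl⟩ := intCast_add_mul_inj hθ (r := X) (s := Y) (r' := 2 * r) (s' := 2 * s)
    (by push_cast; linear_combination hμ)
  have h1 : 2 ∣ x := Int.prime_two.dvd_of_dvd_pow (hX.dvd_iff.1 ⟨r, rfl⟩)
  have h2 : 2 ∣ x + y := Int.prime_two.dvd_of_dvd_pow
    (hXY.dvd_iff.1 ⟨r + s, by ring⟩)
  exact ⟨h1, (Int.dvd_add_right h1).1 h2⟩

/-- A divisor of `2` in `ℤ[θ]` is a unit or an associate of `2`. -/
theorem isUnit_or_two_dvd [CharZero R] (hθ : θ ^ 2 - θ + 6 = 0) {r s r' s' : ℤ}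
    (h : ((r : R) + s * θ) * (r' + s' * θ) = 2) :
    IsUnit ((r : R) + s * θ) ∨ 2 ∣ (r : R) + s * θ := by
  obtain ⟨h1, h2⟩ := intCast_add_mul_inj hθ (r := r * r' - 6 * (s * s'))
    (s := r * s' + s * r' + s * s') (r' := 2) (s' := 0)
    (by push_cast; linear_combination h - (s * s' : R) * hθ)
  have hunit : ∀ {r s : ℤ}, r ^ 2 + r * s + 6 * s ^ 2 = 1 → IsUnit ((r : R) + s * θ) := by
    intro r s h
    have h' : ((r ^ 2 + r * s + 6 * s ^ 2 : ℤ) : R) = 1 := by rw [h]; simp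
    push_cast at h'
    refine IsUnit.of_mul_eq_one ((r : R) + s * (1 - θ)) ?_
    linear_combination h' - (s : R) ^ 2 * hθ
  have hq : (r ^ 2 + r * s + 6 * s ^ 2) * (r' ^ 2 + r' * s' + 6 * s' ^ 2) = 4 := by
    linear_combination (r * r' - 6 * (s * s') + 2) * h1 +
      (r * r' - 6 * (s * s') + 6 * (r * s' + s * r' + s * s')) * h2
  have hpos : ∀ r s : ℤ, 0 ≤ r ^ 2 + r * s + 6 * s ^ 2 := fun r s => by
    nlinarith [sq_nonneg (2 * r + s), sq_nonneg s]
  have hle : r ^ 2 + r * s + 6 * s ^ 2 ≤ 4 := Int.le_of_dvd (by norm_num) ⟨_, hq.symm⟩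
  have hnn := hpos r s
  have hs : s = 0 := by
    by_contra hs
    have : 0 < s ^ 2 := by positivity
    nlinarith [sq_nonneg (2 * r + s)]
  subst hs
  have hr : r ≤ 2 := by nlinarith
  have hr' : -2 ≤ r := by nlinarith
  interval_cases r <;> first | (exfalso; omega) | simp

/-- The descent obstruction behind the Birch--Swinnerton-Dyer surface. -/
theorem not_two_mul_norm_eq [IsDomain R] [CharZero R] [IsPrincipalIdealRing R]
    (hθ : θ ^ 2 - θ + 6 = 0) {σ : R →+* R}
    (hσ : ∀ x, σ (σ (σ x)) = x) (hσθ : σ θ = θ)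
    (hfix : ∀ x, σ x = x → ∃ r s : ℤ, x = r + s * θ) {ξ : R} {D t x y : ℤ} (hD : D ≠ 0)
    (ht : t ≠ 0) (hcop : IsCoprime ((x : R) + y * θ) (t * (x + y * (1 - θ))))
    (h2 : 2 ∣ x ^ 2 + x * y + 6 * y ^ 2) (hxy : ¬(2 ∣ x ∧ 2 ∣ y)) :
    2 * (ξ * σ ξ * σ (σ ξ)) ≠ D ^ 3 * (t * (x + y * (1 - θ))) * (x + y * θ) := by
  intro heq
  set A : R := x + y * θ with hA
  set A' : R := x + y * (1 - θ) with hA'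
  have hσA : σ A = A := by simp [hA, hσθ]
  have hAA : A * A' = ((x ^ 2 + x * y + 6 * y ^ 2 : ℤ) : R) := by
    push_cast
    linear_combination -(y : R) ^ 2 * hθ
  have hA0 : A ≠ 0 := by
    intro h
    obtain ⟨rfl, rfl⟩ := intCast_add_mul_eq_zero hθ h
    exact hxy ⟨dvd_zero _, dvd_zero _⟩
  have hA'0 : A' ≠ 0 := by
    intro h
    have := intCast_add_mul_eq_zero hθ (r := x + y) (s := -y)
      (by push_cast; linear_combination h)
    obtain rfl : y = 0 := by omega
    obtain rfl : x = 0 := by omega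
    exact hxy ⟨dvd_zero _, dvd_zero _⟩
  have hD' : (D : R) ≠ 0 := Int.cast_ne_zero.2 hD
  have ht' : (t : R) ≠ 0 := Int.cast_ne_zero.2 ht
  have hξ : ξ ≠ 0 := by
    rintro rfl
    simp [hA0, hA'0, hD', ht'] at heq
  have hdvd : ∀ {u : R} {n : ℕ}, u ∣ A ^ n → u * σ u * σ (σ u) ∣ A ^ (n + n + n) := by
    intro u n h
    have h1 : σ u ∣ A ^ n := by simpa [hσA] using map_dvd σ h
    have h2 : σ (σ u) ∣ A ^ n := by simpa [hσA] using map_dvd σ h1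
    rw [pow_add, pow_add]
    exact mul_dvd_mul (mul_dvd_mul h h1) h2
  have hcopN : ∀ {v : R}, IsCoprime v A → IsCoprime (v * σ v * σ (σ v)) A := by
    intro v h
    have h1 : IsCoprime (σ v) A := by simpa [hσA] using h.map σ
    have h2 : IsCoprime (σ (σ v)) A := by simpa [hσA] using h1.map σ
    exact (h.mul_left h1).mul_left h2
  have hσN : ∀ u : R, σ (u * σ u * σ (σ u)) = u * σ u * σ (σ u) := by
    intro u
    simp only [map_mul, hσ]
    ring
  obtain ⟨u, v, n₁, huv, hv, hu⟩ := exists_eq_mul_isCoprime_dvd_pow A hξ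
  obtain ⟨d, d', n₂, hdd, hd', hd⟩ := exists_eq_mul_isCoprime_dvd_pow A hD'
  obtain ⟨P, P', n₃, hPP, hP', hP⟩ := exists_eq_mul_isCoprime_dvd_pow A (two_ne_zero (α := R))
  have hU0 : u * σ u * σ (σ u) ≠ 0 := by
    have hu0 : u ≠ 0 := left_ne_zero_of_mul (huv ▸ hξ)
    have hinj : ∀ {w : R}, w ≠ 0 → σ w ≠ 0 := fun {w} hw h0 => hw (by rw [← hσ w, h0]; simp)
    exact mul_ne_zero (mul_ne_zero hu0 (hinj hu0)) (hinj (hinj hu0))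
  have hDN : (D : R) ^ 3 = (d * σ d * σ (σ d)) * (d' * σ d' * σ (σ d')) := by
    have h1 : (D : R) = σ d * σ d' := by simpa using congrArg σ hdd
    have h2 : (D : R) = σ (σ d) * σ (σ d') := by simpa using congrArg σ h1
    calc (D : R) ^ 3 = D * D * D := by ring
      _ = (d * d') * (σ d * σ d') * (σ (σ d) * σ (σ d')) := by
        nth_rw 1 [hdd]; nth_rw 1 [h1]; rw [h2]
      _ = _ := by ring
  have hvN := hcopN hv
  have hdN' := hcopN hd'
  have huN := hdvd hu
  have hdN := hdvd hd
  have hUσ := hσN u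
  have hVσ := hσN d
  have heq' : P * P' * ((u * σ u * σ (σ u)) * (v * σ v * σ (σ v))) =
      (d * σ d * σ (σ d)) * (d' * σ d' * σ (σ d')) * (t * A') * A := by
    rw [huv, hDN, hPP] at heq
    simp only [map_mul] at heq
    linear_combination heq
  generalize u * σ u * σ (σ u) = U at *
  generalize d * σ d * σ (σ d) = V at *
  have hassoc : Associated (V * A) (P * U) := by
    refine associated_of_dvd_dvd ?_ ?_
    · have hc : IsCoprime (V * A) (P' * (v * σ v * σ (σ v))) :=
        ((hP'.mul_left hvN).symm.pow_left (m := n₂ + n₂ + n₂ + 1)).of_isCoprime_of_dvd_left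
          (by rw [pow_succ]; exact mul_dvd_mul_right hdN A)
      refine hc.dvd_of_dvd_mul_right ⟨d' * σ d' * σ (σ d') * (t * A'), ?_⟩
      linear_combination heq'
    · have hc : IsCoprime (P * U) ((d' * σ d' * σ (σ d')) * (t * A')) :=
        IsCoprime.of_isCoprime_of_dvd_left
          ((hdN'.mul_left hcop.symm).symm.pow_left (m := n₃ + (n₁ + n₁ + n₁)))
          (by rw [pow_add]; exact mul_dvd_mul hP huN)
      refine hc.dvd_of_dvd_mul_right ⟨P' * (v * σ v * σ (σ v)), ?_⟩
      linear_combination -heq'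
  obtain ⟨ε, hε⟩ := hassoc.symm
  obtain ⟨r₁, s₁, hU⟩ := hfix U hUσ
  set Ub : R := r₁ + s₁ * (1 - θ) with hUb
  have hm : U * Ub = ((r₁ ^ 2 + r₁ * s₁ + 6 * s₁ ^ 2 : ℤ) : R) := by
    rw [hU]
    push_cast
    linear_combination -(s₁ : R) ^ 2 * hθ
  have hm0 : ((r₁ ^ 2 + r₁ * s₁ + 6 * s₁ ^ 2 : ℤ) : R) ≠ 0 := by
    rw [← hm]
    refine mul_ne_zero hU0 fun h => hU0 ?_
    obtain ⟨h1, h2⟩ := intCast_add_mul_eq_zero hθ (r := r₁ + s₁) (s := -s₁)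
      (by push_cast; linear_combination h)
    obtain rfl : s₁ = 0 := by omega
    obtain rfl : r₁ = 0 := by omega
    simp [hU]
  have hκ : P * ε * ((r₁ ^ 2 + r₁ * s₁ + 6 * s₁ ^ 2 : ℤ) : R) = V * A * Ub := by
    rw [← hm]
    linear_combination Ub * hε
  have hσκ : σ (P * ε) = P * ε := by
    refine mul_right_cancel₀ hm0 ?_
    have := congrArg σ hκ
    rw [map_mul σ (P * ε), map_intCast, map_mul σ (V * A), map_mul σ V, hVσ, hσA] at this
    rw [hκ, this]
    simp [hUb, hσθ]
  have hPε : Associated (P * ε) P := (associated_mul_unit_right P ε.1 ε.isUnit).symm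
  obtain ⟨lam, hlam⟩ : P * ε ∣ 2 := hPε.dvd.trans ⟨P', hPP⟩
  have hσlam : σ lam = lam := by
    refine mul_left_cancel₀ (left_ne_zero_of_mul (hlam ▸ two_ne_zero (α := R))) ?_
    rw [← hlam]
    have := congrArg σ hlam
    rw [map_mul, hσκ] at this
    simpa [map_ofNat] using this.symm
  obtain ⟨r, s, hrs⟩ := hfix _ hσκ
  obtain ⟨r', s', hrs'⟩ := hfix _ hσlam
  rcases isUnit_or_two_dvd hθ (r := r) (s := s) (r' := r') (s' := s')
    (by rw [← hrs, ← hrs', ← hlam]) with h | h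
  · rw [← hrs, hPε.isUnit_iff] at h
    have h2A : IsCoprime 2 A := by
      rw [hPP]
      exact (isCoprime_one_left.of_isCoprime_of_dvd_left h.dvd).mul_left hP'
    have : 2 ∣ A' := h2A.dvd_of_dvd_mul_left (by
      rw [hAA]
      simpa using (Int.castRingHom R).map_dvd h2)
    have h3 := even_of_two_dvd_pow hθ hσθ hfix (x := x + y) (y := -y) (k := 1) (by
      convert this using 1
      rw [hA']; push_cast; ring)
    exact hxy (by omega)
  · rw [← hrs] at h
    exact hxy (even_of_two_dvd_pow hθ hσθ hfix ((h.trans hPε.dvd).trans hP))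

end Quadratic

theorem Rat.pow_three_ne_add_one (r : ℚ) : r ^ 3 ≠ r + 1 := by
  intro h
  obtain ⟨n, rfl⟩ := IsIntegrallyClosed.isIntegral_iff.1
    (⟨Polynomial.X ^ 3 - Polynomial.X - 1, by monicity!, by simp [h]⟩ : IsIntegral ℤ r)
  rw [eq_intCast] at h
  have h' : n ^ 3 = n + 1 := by exact_mod_cast h
  have := congrArg (Int.cast : ℤ → ZMod 2) h'
  push_cast at this
  generalize (n : ZMod 2) = m at this
  revert m
  decide

theorem two_dvd_of_two_dvd_cubicNormForm {x z w : ℤ} (h : 2 ∣ cubicNormForm x z w) :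
    2 ∣ x ∧ 2 ∣ z ∧ 2 ∣ w := by
  have key : ∀ n : ℤ, 2 ∣ n ↔ (n : ZMod 2) = 0 := fun n =>
    (ZMod.intCast_zmod_eq_zero_iff_dvd n 2).symm
  simp only [key] at h ⊢
  refine eq_zero_of_cubicNormForm_eq_zero (by decide) ?_
  simpa [cubicNormForm] using h

theorem exists_coprime_adjustment {x y : ℤ} (hc : IsCoprime x y) (hx : 2 ∣ x) (hy : ¬2 ∣ y) :
    ∃ x' y' t : ℤ, t ≠ 0 ∧
      t * (x' ^ 2 + x' * y' + 6 * y' ^ 2) = (x - y) * (x ^ 2 + x * y + 6 * y ^ 2) ∧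
      IsCoprime x' y' ∧ IsCoprime 23 (x' ^ 2 + x' * y' + 6 * y' ^ 2) ∧
      IsCoprime (x' ^ 2 + x' * y' + 6 * y' ^ 2) t ∧
      2 ∣ x' ^ 2 + x' * y' + 6 * y' ^ 2 ∧ ¬(2 ∣ x' ∧ 2 ∣ y') := by
  have h23 : Prime (23 : ℤ) := by norm_num
  have hdvd : ∀ {x y : ℤ}, 23 ∣ x ^ 2 + x * y + 6 * y ^ 2 → 23 ∣ x + 12 * y := by
    rintro x y ⟨k, hk⟩
    have : 23 ∣ 2 * x + y := h23.dvd_of_dvd_pow (n := 2)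
      ⟨4 * k - y ^ 2, by linear_combination 4 * hk⟩
    omega
  have heven : 2 ∣ x ^ 2 + x * y + 6 * y ^ 2 := by
    obtain ⟨k, rfl⟩ := hx
    exact ⟨2 * k ^ 2 + k * y + 3 * y ^ 2, by ring⟩
  have hcop : IsCoprime (x ^ 2 + x * y + 6 * y ^ 2) (x - y) := by
    have h1 : IsCoprime (x - y) y := by simpa [sub_eq_add_neg] using hc.add_mul_right_left (-1)
    have h2 : IsCoprime (x - y) 2 :=
      ((Int.prime_two.irreducible.isCoprime_or_dvd _).resolve_right (by omega)).symm
    have h3 : IsCoprime (x - y) (2 ^ 3 * y ^ 2) := h2.pow_right.mul_right h1.pow_right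
    have h4 := h3.add_mul_left_right (x + 2 * y)
    rw [show 2 ^ 3 * y ^ 2 + (x - y) * (x + 2 * y) = x ^ 2 + x * y + 6 * y ^ 2 by ring] at h4
    exact h4.symm
  rcases h23.irreducible.isCoprime_or_dvd (x ^ 2 + x * y + 6 * y ^ 2) with h | h
  · exact ⟨x, y, x - y, by omega, rfl, hc, h, hcop, heven, fun h => hy h.2⟩
  · obtain ⟨x', hx'⟩ := hdvd h
    obtain ⟨y', rfl⟩ : ∃ y', y = y' + 2 * x' := ⟨y - 2 * x', by ring⟩
    obtain rfl : x = -x' - 12 * y' := by linarith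
    have hq : (-x' - 12 * y') ^ 2 + (-x' - 12 * y') * (y' + 2 * x') + 6 * (y' + 2 * x') ^ 2
        = 23 * (x' ^ 2 + x' * y' + 6 * y' ^ 2) := by ring
    rw [hq] at hcop heven ⊢
    have hc' : IsCoprime x' y' := by
      obtain ⟨u, v, huv⟩ := hc
      exact ⟨-u + 2 * v, -12 * u + v, by linear_combination huv⟩
    have hcop23 : IsCoprime 23 (x' ^ 2 + x' * y' + 6 * y' ^ 2) := by
      refine (h23.irreducible.isCoprime_or_dvd _).resolve_right fun h => ?_
      have := hdvd h
      exact h23.not_isUnit (hc.isUnit_of_dvd' (by omega) (by omega))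
    exact ⟨x', y', 23 * (-x' - 12 * y' - (y' + 2 * x')), by omega, by ring, hc', hcop23,
      hcop23.symm.mul_right hcop.of_mul_left_right,
      Int.prime_two.dvd_or_dvd heven |>.resolve_left (by norm_num), by omega⟩

section

variable {R : Type*} [CommRing R] {θ : R}

theorem isCoprime_conj (hθ : θ ^ 2 - θ + 6 = 0) {x y t : ℤ} (hxy : IsCoprime x y)
    (h23 : IsCoprime 23 (x ^ 2 + x * y + 6 * y ^ 2))
    (ht : IsCoprime (x ^ 2 + x * y + 6 * y ^ 2) t) :
    IsCoprime ((x : R) + y * θ) (t * (x + y * (1 - θ))) := by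
  refine IsCoprime.mul_right ?_ ?_
  · refine IsCoprime.of_mul_left_left (y := (x : R) + y * (1 - θ)) ?_
    have h := ht.map (Int.castRingHom R)
    convert h using 1
    · simp only [eq_intCast]
      push_cast
      linear_combination -(y : R) ^ 2 * hθ
    · simp
  · obtain ⟨u, v, huv⟩ := hxy
    obtain ⟨α, β, hαβ⟩ := h23
    have e1 : (u : R) * x + v * y = 1 := by exact_mod_cast congrArg (Int.cast : ℤ → R) huv
    have e2 : (α : R) * 23 + β * (x ^ 2 + x * y + 6 * y ^ 2) = 1 := by
      exact_mod_cast congrArg (Int.cast : ℤ → R) hαβ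
    refine ⟨α * (-u * (1 - 2 * θ) * (1 - θ) - v * (2 * θ - 1)) + β * (x + y * (1 - θ)),
      α * (u * θ * (1 - 2 * θ) + v * (2 * θ - 1)), ?_⟩
    linear_combination 23 * (α : R) * e1 + e2 -
      (4 * (α : R) * (u * x + v * y) + β * (y : R) ^ 2) * hθ

theorem two_mul_cubicNormForm_ne [IsDomain R] [CharZero R] [IsPrincipalIdealRing R]
    (hθ : θ ^ 2 - θ + 6 = 0)
    {σ : R →+* R} (hσ : ∀ x, σ (σ (σ x)) = x) (hσθ : σ θ = θ)
    (hfix : ∀ x, σ x = x → ∃ r s : ℤ, x = r + s * θ) {a b : R}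
    (hab : a ^ 2 + a * b + b ^ 2 = 1) (hab' : a ^ 2 * b + a * b ^ 2 = -1) (ha : σ a = b)
    (hb : σ b = -a - b) {x y : ℤ} (hxy : IsCoprime x y) (D z w : ℤ) (hD : D ≠ 0) :
    2 * cubicNormForm (D * x) z w ≠ D ^ 3 * ((x - y) * (x ^ 2 + x * y + 6 * y ^ 2)) := by
  induction hn : D.natAbs using Nat.strong_induction_on generalizing D z w with
  | _ n ih =>
    intro heq
    by_cases hD2 : 2 ∣ D
    · obtain ⟨D, rfl⟩ := hD2
      obtain ⟨-, ⟨z, rfl⟩, ⟨w, rfl⟩⟩ := two_dvd_of_two_dvd_cubicNormForm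
        (x := 2 * D * x) (z := z) (w := w)
        ⟨2 * (D ^ 3 * ((x - y) * (x ^ 2 + x * y + 6 * y ^ 2))),
          mul_left_cancel₀ two_ne_zero (by linear_combination heq)⟩
      refine ih D.natAbs (by omega) D z w (by omega) rfl ?_
      unfold cubicNormForm at heq ⊢
      refine mul_left_cancel₀ (show (8 : ℤ) ≠ 0 by norm_num) ?_
      linear_combination heq
    have hD3 : ¬ 2 ∣ D ^ 3 := fun h => hD2 (Int.prime_two.dvd_of_dvd_pow h)
    have hxy2 : 2 ∣ x ∧ ¬ 2 ∣ y := by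
      have h1 : 2 ∣ (x - y) * (x ^ 2 + x * y + 6 * y ^ 2) :=
        (Int.prime_two.dvd_or_dvd ⟨_, heq.symm⟩).resolve_left hD3
      have hnot : ¬(2 ∣ x ∧ 2 ∣ y) := fun h =>
        Int.prime_two.not_isUnit (hxy.isUnit_of_dvd' h.1 h.2)
      by_cases hx : 2 ∣ x
      · exact ⟨hx, fun hy => hnot ⟨hx, hy⟩⟩
      exfalso
      by_cases hy : 2 ∣ y
      · obtain ⟨k, rfl⟩ := hy
        have h2 : 2 ∣ x * x ^ 2 := by
          obtain ⟨l, hl⟩ := h1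
          exact ⟨l - 10 * x * k ^ 2 + 24 * k ^ 3, by linear_combination hl⟩
        rw [← pow_succ'] at h2
        exact hx (Int.prime_two.dvd_of_dvd_pow h2)
      · obtain ⟨k, hk⟩ : 2 ∣ x - y := by omega
        obtain rfl : y = x - 2 * k := by linarith
        have h2 : 2 ∣ cubicNormForm (D * x) z w :=
          ⟨D ^ 3 * (k * (4 * x ^ 2 - 13 * x * k + 12 * k ^ 2)),
            mul_left_cancel₀ two_ne_zero (by linear_combination heq)⟩
        rcases Int.prime_two.dvd_or_dvd (two_dvd_of_two_dvd_cubicNormForm h2).1 with h | h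
        exacts [hD2 h, hx h]
    obtain ⟨x', y', t, ht, hadj, hc, h23, hcop, heven, hne⟩ :=
      exists_coprime_adjustment hxy hxy2.1 hxy2.2
    refine not_two_mul_norm_eq hθ hσ hσθ hfix (ξ := D * x + a * z + a ^ 2 * w) hD ht
      (isCoprime_conj hθ hc h23 hcop) heven hne ?_
    have h1 : (2 : R) * cubicNormForm (D * x : R) z w =
        D ^ 3 * (t * (x' ^ 2 + x' * y' + 6 * y' ^ 2)) := by
      rw [← hadj] at heq
      have := congrArg (Int.cast : ℤ → R) heq
      unfold cubicNormForm at this ⊢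
      push_cast at this
      exact this
    simp only [map_add, map_mul, map_pow, map_intCast, ha, hb]
    rw [prod_eq_cubicNormForm _ _ _ _ _ hab hab', h1]
    linear_combination (D : R) ^ 3 * t * (y' : R) ^ 2 * hθ

end

theorem eq_zero_of_two_mul_cubicNormForm_eq
    (h : ∀ x y : ℤ, IsCoprime x y → ∀ D z w : ℤ, D ≠ 0 →
      2 * cubicNormForm (D * x) z w ≠ D ^ 3 * ((x - y) * (x ^ 2 + x * y + 6 * y ^ 2)))
    {x y z w : ℚ} (heq : 2 * cubicNormForm x z w = (x - y) * (x ^ 2 + x * y + 6 * y ^ 2)) :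
    x = 0 ∧ y = 0 ∧ z = 0 ∧ w = 0 := by
  have key : ∀ z w : ℚ, cubicNormForm 0 z w = 0 → z = 0 ∧ w = 0 := fun z w h =>
    (eq_zero_of_cubicNormForm_eq_zero Rat.pow_three_ne_add_one h).2
  obtain ⟨⟨n, hn⟩, hint⟩ := IsLocalization.exist_integer_multiples_of_finset
    (nonZeroDivisors ℤ) ({x, y, z, w} : Finset ℚ)
  have hn0 : (n : ℚ) ≠ 0 := Int.cast_ne_zero.2 (nonZeroDivisors.ne_zero hn)
  obtain ⟨X, hX⟩ := hint x (by simp)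
  obtain ⟨Y, hY⟩ := hint y (by simp)
  obtain ⟨Z, hZ⟩ := hint z (by simp)
  obtain ⟨W, hW⟩ := hint w (by simp)
  simp only [eq_intCast, zsmul_eq_mul] at hX hY hZ hW
  by_cases hxy : x = 0 ∧ y = 0
  · obtain ⟨rfl, rfl⟩ := hxy
    exact ⟨rfl, rfl, key z w (by simpa using heq)⟩
  exfalso
  have hg : 0 < Int.gcd X Y := by
    refine Int.gcd_pos_iff.2 (not_and_or.1 fun h0 => hxy ?_)
    rw [h0.1] at hX
    rw [h0.2] at hY
    simpa [hn0, eq_comm] using And.intro hX hY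
  obtain ⟨x', y', hc, hx', hy'⟩ := Int.exists_gcd_one hg
  refine h x' y' (Int.isCoprime_iff_gcd_eq_one.2 hc) (Int.gcd X Y) Z W (by omega) ?_
  have : 2 * cubicNormForm (X : ℚ) Z W = (X - Y) * (X ^ 2 + X * Y + 6 * Y ^ 2) := by
    rw [hX, hY, hZ, hW]
    unfold cubicNormForm at heq ⊢
    linear_combination (n : ℚ) ^ 3 * heq
  have h' : 2 * cubicNormForm X Z W = (X - Y) * (X ^ 2 + X * Y + 6 * Y ^ 2) := by
    unfold cubicNormForm at this ⊢
    exact_mod_cast this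
  rw [mul_comm _ x', ← hx', h']
  generalize (Int.gcd X Y : ℤ) = g at *
  rw [hx', hy']
  ring

open Polynomial in
theorem AdjoinRoot.exists_eq_sum_and_eq_zero {F : Type*} [Field F] {g : F[X]} (hg : g.Monic)
    {n : ℕ} (hn : g.natDegree = n) :
    (∀ x : AdjoinRoot g, ∃ c : Fin n → F, x = ∑ i, of g (c i) * root g ^ (i : ℕ)) ∧
      ∀ c : Fin n → F, ∑ i, of g (c i) * root g ^ (i : ℕ) = 0 → ∀ i, c i = 0 := by
  subst hn
  let B := (powerBasis' hg).basis
  have hB : ∀ i : Fin g.natDegree, B i = root g ^ (i : ℕ) := fun i => by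
    simp [B, PowerBasis.coe_basis]
  refine ⟨fun x => ⟨B.repr x, ?_⟩, fun c hc => ?_⟩
  · conv_lhs => rw [← B.sum_repr x]
    refine Finset.sum_congr rfl fun i _ => ?_
    rw [Algebra.smul_def, ← hB i]
    rfl
  · refine Fintype.linearIndependent_iff.1 B.linearIndependent c ?_
    rw [← hc]
    refine Finset.sum_congr rfl fun i _ => ?_
    rw [Algebra.smul_def, ← hB i]
    rfl

/-- `L` is the splitting field of `t³ - t - 1` over `ℚ`, generated by the roots `a` and `b`; the
automorphism `σ` permutes the roots `a`, `b`, `-a - b` cyclically and `τ` exchanges `a` and `b`. -/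
structure IsCubicSplittingField {L : Type*} [Field L] [CharZero L] (a b : L) (σ τ : L →+* L) :
    Prop where
  quadratic_eq : a ^ 2 + a * b + b ^ 2 = 1
  cubic_eq : a ^ 2 * b + a * b ^ 2 = -1
  map_root : σ a = b ∧ σ b = -a - b
  swap_root : τ a = b ∧ τ b = a
  exists_coeff (x : L) : ∃ c : Fin 6 → ℚ,
    x = c 0 + c 1 * a + c 2 * a ^ 2 + c 3 * b + c 4 * (a * b) + c 5 * (a ^ 2 * b)
  coeff_eq_zero (c : Fin 6 → ℚ) :
    (c 0 + c 1 * a + c 2 * a ^ 2 + c 3 * b + c 4 * (a * b) + c 5 * (a ^ 2 * b) : L) = 0 →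
      ∀ i, c i = 0

open Polynomial AdjoinRoot in
theorem exists_isCubicSplittingField (φ : ℝ) (hφ : φ ^ 3 = φ + 1) :
    ∃ (L : Type) (_ : Field L) (_ : CharZero L) (a b : L) (σ τ : L →+* L),
      IsCubicSplittingField a b σ τ := by
  let f : ℚ[X] := X ^ 3 - X - 1
  have hfm : f.Monic := by simp only [f]; monicity!
  have hfd : f.natDegree = 3 := by simp only [f]; compute_degree!
  have hfirr : Irreducible f := by
    rw [irreducible_iff_roots_eq_zero_of_degree_le_three (by omega) (by omega),
      Multiset.eq_zero_iff_forall_notMem]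
    intro r hr
    have := (mem_roots'.1 hr).2
    simp only [f, IsRoot.def, eval_sub, eval_pow, eval_X, eval_one] at this
    exact Rat.pow_three_ne_add_one r (by linear_combination this)
  have : Fact (Irreducible f) := ⟨hfirr⟩
  let α : AdjoinRoot f := root f
  have hα : α ^ 3 = α + 1 := by
    have := eval₂_root f
    simp only [f, eval₂_sub, eval₂_pow, eval₂_X, eval₂_one] at this
    linear_combination this
  let g : (AdjoinRoot f)[X] := X ^ 2 + C α * X + C (α ^ 2 - 1)
  have hgm : g.Monic := by simp only [g]; monicity!
  have hgd : g.natDegree = 2 := by simp only [g]; compute_degree!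
  have hgirr : Irreducible g := by
    rw [irreducible_iff_roots_eq_zero_of_degree_le_three (by omega) (by omega),
      Multiset.eq_zero_iff_forall_notMem]
    intro r hr
    have hr := (mem_roots'.1 hr).2
    simp only [g, IsRoot.def, eval_add, eval_mul, eval_pow, eval_X, eval_C] at hr
    let ι : AdjoinRoot f →+* ℝ := lift (algebraMap ℚ ℝ) φ (by
      simp only [f, eval₂_sub, eval₂_pow, eval₂_X, eval₂_one]
      linear_combination hφ)
    have hια : ι α = φ := lift_root _
    have := congrArg ι hr
    simp only [map_add, map_mul, map_pow, map_sub, map_one, map_zero, hια] at this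
    nlinarith [sq_nonneg (2 * ι r + φ), sq_nonneg (φ - 1), sq_nonneg (φ + 1)]
  have : Fact (Irreducible g) := ⟨hgirr⟩
  have heval : ∀ {S : Type} [CommRing S] (ρ : AdjoinRoot f →+* S) (x : S),
      eval₂ ρ x g = x ^ 2 + ρ α * x + (ρ α ^ 2 - 1) := fun ρ x => by
    simp only [g, eval₂_add, eval₂_mul, eval₂_pow, eval₂_X, eval₂_C, map_sub ρ, map_pow ρ,
      map_one ρ]
  let a : AdjoinRoot g := of g α
  let b : AdjoinRoot g := root g
  have hab : a ^ 2 + a * b + b ^ 2 = 1 := by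
    have := eval₂_root g
    rw [heval] at this
    linear_combination this
  have ha : a ^ 3 = a + 1 := by
    simpa using congrArg (of g) hα
  have hab' : a ^ 2 * b + a * b ^ 2 = -1 := by linear_combination a * hab - ha
  have hb : b ^ 3 = b + 1 := by linear_combination b * hab - hab'
  let σ₀ : AdjoinRoot f →+* AdjoinRoot g := lift (algebraMap ℚ _) b (by
    simp only [f, eval₂_sub, eval₂_pow, eval₂_X, eval₂_one]
    linear_combination hb)
  have hσ₀ : σ₀ α = b := lift_root _
  let σ : AdjoinRoot g →+* AdjoinRoot g := lift σ₀ (-a - b) (by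
    rw [heval, hσ₀]
    linear_combination hab)
  let τ : AdjoinRoot g →+* AdjoinRoot g := lift σ₀ a (by
    rw [heval, hσ₀]
    linear_combination hab)
  have : CharZero (AdjoinRoot g) := charZero_of_injective_algebraMap
    (algebraMap ℚ (AdjoinRoot g)).injective
  refine ⟨AdjoinRoot g, inferInstance, inferInstance, a, b, σ, τ, hab, hab',
    ⟨(lift_of _).trans hσ₀, lift_root _⟩, ⟨(lift_of _).trans hσ₀, lift_root _⟩, ?_, ?_⟩
  · intro x
    obtain ⟨k, rfl⟩ := (exists_eq_sum_and_eq_zero hgm hgd).1 x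
    obtain ⟨c, hc⟩ := (exists_eq_sum_and_eq_zero hfm hfd).1 (k 0)
    obtain ⟨d, hd⟩ := (exists_eq_sum_and_eq_zero hfm hfd).1 (k 1)
    refine ⟨![c 0, c 1, c 2, d 0, d 1, d 2], ?_⟩
    rw [Fin.sum_univ_two, hc, hd, Fin.sum_univ_three, Fin.sum_univ_three]
    simp [a, b, α]
    ring
  · intro c hc
    have h := (exists_eq_sum_and_eq_zero hgm hgd).2
      ![c 0 + c 1 * α + c 2 * α ^ 2, c 3 + c 4 * α + c 5 * α ^ 2] (by
        rw [← hc, Fin.sum_univ_two]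
        simp [a, b]
        ring)
    have h0 := (exists_eq_sum_and_eq_zero hfm hfd).2 ![c 0, c 1, c 2] (by
      have := h 0
      rw [Fin.sum_univ_three]
      simpa [α] using this)
    have h1 := (exists_eq_sum_and_eq_zero hfm hfd).2 ![c 3, c 4, c 5] (by
      have := h 1
      rw [Fin.sum_univ_three]
      simpa [α] using this)
    intro i
    fin_cases i
    exacts [h0 0, h0 1, h0 2, h1 0, h1 1, h1 2]

theorem NumberField.abs_discr_le_abs_discr_basis {K : Type*} [Field K] [NumberField K] {ι : Type*}
    [Fintype ι] [DecidableEq ι] (B : Module.Basis ι ℚ K) (hB : ∀ i, IsIntegral ℤ (B i)) :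
    |(NumberField.discr K : ℚ)| ≤ |Algebra.discr ℚ B| := by
  classical
  let B' := NumberField.integralBasis K
  let e := B'.indexEquiv B
  let P := (B'.reindex e).toMatrix B
  have hP : IsIntegral ℤ P.det := IsIntegral.det fun i j => by
    have hij : B'.repr (B j) (e.symm i) = algebraMap ℤ ℚ _ :=
      NumberField.integralBasis_repr_apply K ⟨B j, hB j⟩ (e.symm i)
    change IsIntegral ℤ ((B'.reindex e).toMatrix B i j)
    rw [Module.Basis.toMatrix_apply, Module.Basis.repr_reindex_apply, hij]
    exact isIntegral_algebraMap
  obtain ⟨m, hm⟩ := IsIntegrallyClosed.isIntegral_iff.1 hP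
  have key : Algebra.discr ℚ B = (m : ℚ) ^ 2 * NumberField.discr K := by
    rw [← (B'.reindex e).toMatrix_map_vecMul B, Algebra.discr_of_matrix_vecMul,
      Module.Basis.coe_reindex, Algebra.discr_reindex, NumberField.coe_discr]
    change P.det ^ 2 * _ = _
    rw [← hm]
    rfl
  have hm0 : m ≠ 0 := by
    rintro rfl
    apply Algebra.discr_not_zero_of_basis ℚ B
    simpa using key
  rw [key, abs_mul]
  refine le_mul_of_one_le_left (abs_nonneg _) ?_
  rw [abs_of_nonneg (sq_nonneg _)]
  exact_mod_cast Int.add_one_le_of_lt (sq_pos_of_ne_zero hm0)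

open Polynomial in
theorem isIntegral_of_pow_three_eq {R : Type*} [CommRing R] {x : R} (hx : x ^ 3 = x + 1) :
    IsIntegral ℤ x :=
  ⟨X ^ 3 - X - 1, by monicity!, by simp [hx]⟩

namespace IsCubicSplittingField

variable {L : Type*} [Field L] [CharZero L] {a b : L} {σ τ : L →+* L}

theorem root_pow_three (h : IsCubicSplittingField a b σ τ) : a ^ 3 = a + 1 := by
  linear_combination a * h.quadratic_eq - h.cubic_eq

theorem root_pow_three' (h : IsCubicSplittingField a b σ τ) : b ^ 3 = b + 1 := by
  linear_combination b * h.quadratic_eq - h.cubic_eq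

theorem isIntegral_fst (h : IsCubicSplittingField a b σ τ) : IsIntegral ℤ a :=
  isIntegral_of_pow_three_eq h.root_pow_three

theorem isIntegral_snd (h : IsCubicSplittingField a b σ τ) : IsIntegral ℤ b :=
  isIntegral_of_pow_three_eq h.root_pow_three'

theorem exists_basis (h : IsCubicSplittingField a b σ τ) :
    ∃ B : Module.Basis (Fin 6) ℚ L, ∀ i, B i = a ^ (i % 3 : ℕ) * b ^ (i / 3 : ℕ) := by
  have hsum : ∀ c : Fin 6 → ℚ, ∑ i, c i • (a ^ (i % 3 : ℕ) * b ^ (i / 3 : ℕ)) =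
      c 0 + c 1 * a + c 2 * a ^ 2 + c 3 * b + c 4 * (a * b) + c 5 * (a ^ 2 * b) := fun c => by
    simp [Fin.sum_univ_six, Rat.smul_def]
  refine ⟨Module.Basis.mk (v := fun i : Fin 6 => a ^ (i % 3 : ℕ) * b ^ (i / 3 : ℕ))
    (Fintype.linearIndependent_iff.2 fun c hc => h.coeff_eq_zero c (by rw [← hsum, hc]))
    fun x _ => ?_, fun i => by simp⟩
  obtain ⟨c, rfl⟩ := h.exists_coeff x
  rw [← hsum]
  exact Submodule.sum_smul_mem _ _ fun i _ => Submodule.subset_span ⟨i, rfl⟩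

theorem numberField (h : IsCubicSplittingField a b σ τ) : NumberField L :=
  have ⟨B, _⟩ := h.exists_basis
  { to_charZero := inferInstance, to_finiteDimensional := .of_basis B }

theorem finrank_eq (h : IsCubicSplittingField a b σ τ) : Module.finrank ℚ L = 6 := by
  obtain ⟨B, _⟩ := h.exists_basis
  simp [Module.finrank_eq_card_basis B]

end IsCubicSplittingField

theorem Algebra.trace_map_rat {L : Type*} [Field L] [NumberField L] (σ : L →+* L) (x : L) :
    Algebra.trace ℚ L (σ x) = Algebra.trace ℚ L x :=
  Algebra.trace_eq_of_algEquiv (AlgEquiv.ofBijective σ.toRatAlgHom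
    (σ.toRatAlgHom.bijective)) x

namespace IsCubicSplittingField

variable {L : Type*} [Field L] [CharZero L] {a b : L} {σ τ : L →+* L}

theorem trace_eq [NumberField L] (h : IsCubicSplittingField a b σ τ) (c : Fin 6 → ℚ) :
    Algebra.trace ℚ L
      (c 0 + c 1 * a + c 2 * a ^ 2 + c 3 * b + c 4 * (a * b) + c 5 * (a ^ 2 * b)) =
      6 * c 0 + 4 * c 2 - 2 * c 4 - 3 * c 5 := by
  have hq := h.quadratic_eq
  have h1 : Algebra.trace ℚ L 1 = 6 := by
    simpa [h.finrank_eq] using Algebra.trace_algebraMap (S := L) (1 : ℚ)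
  have hb : Algebra.trace ℚ L b = Algebra.trace ℚ L a := by
    rw [← Algebra.trace_map_rat σ a, h.map_root.1]
  have ha : Algebra.trace ℚ L a = 0 := by
    have := Algebra.trace_map_rat σ b
    rw [h.map_root.2, map_sub, map_neg, hb] at this
    linarith
  have hb2 : Algebra.trace ℚ L (b ^ 2) = Algebra.trace ℚ L (a ^ 2) := by
    rw [← Algebra.trace_map_rat σ (a ^ 2), map_pow σ, h.map_root.1]
  have hab : Algebra.trace ℚ L (a * b) = Algebra.trace ℚ L (a ^ 2) - 6 := by
    rw [← Algebra.trace_map_rat σ (a * b), map_mul, h.map_root.1, h.map_root.2, ← h1, ← map_sub]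
    congr 1
    linear_combination -hq
  have ha2 : Algebra.trace ℚ L (a ^ 2) = 4 := by
    have := congrArg (Algebra.trace ℚ L) hq
    rw [map_add, map_add, hb2, hab, h1] at this
    linarith
  have ha2b : Algebra.trace ℚ L (a ^ 2 * b) = -3 := by
    have := congrArg (Algebra.trace ℚ L) h.cubic_eq
    have hs := Algebra.trace_map_rat τ (a ^ 2 * b)
    rw [map_mul, map_pow, h.swap_root.1, h.swap_root.2] at hs
    rw [map_add, mul_comm a (b ^ 2), hs, map_neg, h1] at this
    linarith
  rw [show (c 0 : L) = c 0 * 1 by rw [mul_one]]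
  simp only [← Rat.smul_def, map_add, map_smul, h1, ha, hb, ha2, hab, ha2b,
    smul_eq_mul]
  ring

theorem trace_pow_mul_pow [NumberField L] (h : IsCubicSplittingField a b σ τ) (m : Fin 5)
    (n : Fin 3) : Algebra.trace ℚ L (a ^ (m : ℕ) * b ^ (n : ℕ)) =
      !![6, 0, 4; 0, -2, -3; 4, -3, 2; 6, -2, 1; 4, -5, -1] m n := by
  have hq := h.quadratic_eq
  have hc := h.cubic_eq
  have ha := h.root_pow_three
  let c : Fin 5 → Fin 3 → Fin 6 → ℚ :=
    ![![![1, 0, 0, 0, 0, 0], ![0, 0, 0, 1, 0, 0], ![1, 0, -1, 0, -1, 0]],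
      ![![0, 1, 0, 0, 0, 0], ![0, 0, 0, 0, 1, 0], ![-1, 0, 0, 0, 0, -1]],
      ![![0, 0, 1, 0, 0, 0], ![0, 0, 0, 0, 0, 1], ![0, -1, 0, -1, -1, 0]],
      ![![1, 1, 0, 0, 0, 0], ![0, 0, 0, 1, 1, 0], ![0, 0, -1, 0, -1, -1]],
      ![![0, 1, 1, 0, 0, 0], ![0, 0, 0, 0, 1, 1], ![-1, -1, 0, -1, -1, -1]]]
  have hmn : a ^ (m : ℕ) * b ^ (n : ℕ) = c m n 0 + c m n 1 * a + c m n 2 * a ^ 2 + c m n 3 * b +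
      c m n 4 * (a * b) + c m n 5 * (a ^ 2 * b) := by
    fin_cases m <;> fin_cases n <;> simp [c] <;> grind
  rw [hmn, h.trace_eq]
  fin_cases m <;> fin_cases n <;> simp [c] <;> norm_num

theorem exists_basis_discr_eq [NumberField L] (h : IsCubicSplittingField a b σ τ) :
    ∃ B : Module.Basis (Fin 6) ℚ L, (∀ i, IsIntegral ℤ (B i)) ∧ Algebra.discr ℚ B = -12167 := by
  obtain ⟨B, hB⟩ := h.exists_basis
  refine ⟨B, fun i => hB i ▸ (h.isIntegral_fst.pow _).mul (h.isIntegral_snd.pow _), ?_⟩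
  let l : Matrix (Fin 6) (Fin 6) ℚ := !![1, 0, 0, 0, 0, 0; 0, 1, 0, 0, 0, 0; 2/3, 3/2, 1, 0, 0, 0;
    0, -1/2, 0, 1, 0, 0; -1/3, -3/4, -1/2, -3/2, 1, 0; -1/2, -1/2, 0, 1/3, 0, 1]
  let u : Matrix (Fin 6) (Fin 6) ℚ := !![6, 0, 4, 0, -2, -3; 0, 4, 6, -2, -3, -2;
    0, 0, -23/3, 0, 23/6, 0; 0, 0, 0, 3, -9/2, 1; 0, 0, 0, 0, -23/4, 0; 0, 0, 0, 0, 0, -23/6]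
  have hlu : Algebra.traceMatrix ℚ B = l * u := by
    let p (i j : Fin 6) : Fin 5 := ⟨i % 3 + j % 3, by omega⟩
    let q (i j : Fin 6) : Fin 3 := ⟨i / 3 + j / 3, by omega⟩
    have : Algebra.traceMatrix ℚ B = Matrix.of fun i j =>
        !![6, 0, 4; 0, -2, -3; 4, -3, 2; 6, -2, 1; 4, -5, -1] (p i j) (q i j) := by
      ext i j
      rw [Algebra.traceMatrix_apply, Algebra.traceForm_apply, hB, hB, Matrix.of_apply,
        ← h.trace_pow_mul_pow]
      simp only [p, q, pow_add]
      ring_nf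
    rw [this]
    ext i j
    fin_cases i <;> fin_cases j <;> simp [p, q, l, u, Matrix.mul_apply, Fin.sum_univ_six] <;>
      norm_num
  rw [Algebra.discr_def, hlu, Matrix.det_mul, Matrix.det_of_isLowerTriangular,
    Matrix.det_of_isUpperTriangular]
  · simp [l, u, Fin.prod_univ_six]
    norm_num
  all_goals
    intro i j hij
    fin_cases i <;> fin_cases j <;> first | exact absurd hij (by decide) | rfl

end IsCubicSplittingField

namespace NumberField

open InfinitePlace

theorem isTotallyComplex_of_sq_sub_add_six_eq_zero {K : Type*} [Field K] {θ : K}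
    (hθ : θ ^ 2 - θ + 6 = 0) : IsTotallyComplex K where
  isComplex w := by
    rw [← not_isReal_iff_isComplex]
    intro hw
    have := congrArg (embedding_of_isReal hw) hθ
    simp only [map_add, map_sub, map_pow, map_zero, map_ofNat] at this
    nlinarith [sq_nonneg (2 * embedding_of_isReal hw θ - 1)]

theorem minkowskiBound_lt_four {K : Type*} [Field K] [NumberField K] [IsTotallyComplex K]
    (hK : Module.finrank ℚ K = 6) (hd : |(discr K : ℚ)| ≤ 12167) :
    (4 / Real.pi) ^ nrComplexPlaces K * ((Module.finrank ℚ K).factorial /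
      (Module.finrank ℚ K) ^ (Module.finrank ℚ K) * √|(discr K : ℝ)|) < 4 := by
  have hc : nrComplexPlaces K = 3 := by
    have := IsTotallyComplex.finrank K
    omega
  have hd' : √|(discr K : ℝ)| ≤ 111 := by
    rw [Real.sqrt_le_left (by norm_num)]
    exact le_trans (by exact_mod_cast hd) (by norm_num : (12167 : ℝ) ≤ 111 ^ 2)
  have hpi : 4 / Real.pi ≤ 1.28 := by
    rw [div_le_iff₀ Real.pi_pos]
    linarith [Real.pi_gt_d2]
  rw [hc, hK]
  calc _ ≤ (1.28 : ℝ) ^ 3 * ((6).factorial / ((6 : ℕ) : ℝ) ^ 6 * 111) := by gcongr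
    _ < 4 := by norm_num [Nat.factorial]

theorem isPrincipalIdealRing_of_pow_three_eq {K : Type*} [Field K] [NumberField K]
    [IsTotallyComplex K] (hK : Module.finrank ℚ K = 6) (hd : |(discr K : ℚ)| ≤ 12167) {a : 𝓞 K}
    (ha : a ^ 3 = a + 1) : IsPrincipalIdealRing (𝓞 K) := by
  refine RingOfIntegers.isPrincipalIdealRing_of_isPrincipal_of_norm_le_of_isPrime fun I hI hN => ?_
  have hlt : Ideal.absNorm (I : Ideal (𝓞 K)) < 4 := by
    exact_mod_cast hN.trans_lt (minkowskiBound_lt_four hK hd)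
  have hpos : 0 < Ideal.absNorm (I : Ideal (𝓞 K)) := Ideal.absNorm_pos_of_nonZeroDivisors I
  have hone : Ideal.absNorm (I : Ideal (𝓞 K)) ≠ 1 := Ideal.absNorm_eq_one_iff.not.2 hI.ne_top
  have hp (p : ℕ) [Fact p.Prime] (hroot : ∀ t : ZMod p, t ^ 3 ≠ t + 1) :
      Ideal.absNorm (I : Ideal (𝓞 K)) ≠ p := by
    intro h
    rw [Ideal.absNorm_apply, Submodule.cardQuot_apply] at h
    have : Finite (𝓞 K ⧸ (I : Ideal (𝓞 K))) :=
      Nat.finite_of_card_ne_zero (h ▸ (Fact.out : p.Prime).ne_zero)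
    have := Fintype.ofFinite (𝓞 K ⧸ (I : Ideal (𝓞 K)))
    rw [Nat.card_eq_fintype_card] at h
    let e := (ZMod.ringEquivOfPrime _ Fact.out h).symm
    refine hroot (e (Ideal.Quotient.mk _ a)) ?_
    rw [← map_pow, ← map_pow, ha, map_add, map_add, map_one, map_one]
  have := hp 2 (by decide)
  have := hp 3 (by decide)
  omega

end NumberField

namespace IsCubicSplittingField

variable {L : Type*} [Field L] [CharZero L] {a b : L} {σ τ : L →+* L}

theorem quadratic_root_eq (h : IsCubicSplittingField a b σ τ) :
    (-1 - a + b - 3 * a ^ 2 * b) ^ 2 - (-1 - a + b - 3 * a ^ 2 * b) + 6 = 0 := by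
  have hq := h.quadratic_eq
  have hc := h.cubic_eq
  grind

theorem pow_three_map (h : IsCubicSplittingField a b σ τ) (x : L) : σ (σ (σ x)) = x := by
  obtain ⟨c, rfl⟩ := h.exists_coeff x
  simp only [map_add, map_mul, map_pow, map_ratCast, map_sub, map_neg, h.map_root.1, h.map_root.2]
  ring

theorem isPrincipalIdealRing [NumberField L] (h : IsCubicSplittingField a b σ τ) :
    IsPrincipalIdealRing (NumberField.RingOfIntegers L) := by
  obtain ⟨B, hB, hd⟩ := h.exists_basis_discr_eq
  have hdiscr := NumberField.abs_discr_le_abs_discr_basis B hB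
  rw [hd] at hdiscr
  have := NumberField.isTotallyComplex_of_sq_sub_add_six_eq_zero h.quadratic_root_eq
  exact NumberField.isPrincipalIdealRing_of_pow_three_eq h.finrank_eq
    (hdiscr.trans (by norm_num)) (a := ⟨a, h.isIntegral_fst⟩)
    (NumberField.RingOfIntegers.ext h.root_pow_three)

theorem exists_eq_add_mul_of_map_eq (h : IsCubicSplittingField a b σ τ) {x : L} (hx : σ x = x) :
    ∃ r s : ℚ, x = r + s * (-1 - a + b - 3 * a ^ 2 * b) := by
  obtain ⟨c, hc⟩ := h.exists_coeff x
  have hq := h.quadratic_eq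
  have h3 := h.root_pow_three
  have hcc := h.cubic_eq
  have hx' := hx
  rw [hc] at hx'
  simp only [map_add, map_mul, map_pow, map_ratCast, h.map_root.1, h.map_root.2] at hx'
  have hzero := h.coeff_eq_zero ![c 2 - c 4, -c 1 - c 3, -2 * c 2 + c 4, c 1 - 2 * c 3 - c 5,
    -c 2 - c 4, 0] (by
      simp
      grind)
  have e1 := hzero 1
  have e2 := hzero 2
  have e3 := hzero 3
  have e4 := hzero 4
  simp at e1 e2 e3 e4
  refine ⟨c 0 + c 3, c 3, ?_⟩
  rw [hc, show c 1 = -c 3 by linarith, show c 5 = -3 * c 3 by linarith,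
    show c 2 = 0 by linarith, show c 4 = 0 by linarith]
  push_cast
  ring

end IsCubicSplittingField

theorem Rat.exists_eq_intCast_of_trace_norm {r s : ℚ} {m n : ℤ} (hm : 2 * r + s = m)
    (hn : r ^ 2 + r * s + 6 * s ^ 2 = n) : ∃ r' s' : ℤ, r = r' ∧ s = s' := by
  have hsq : (23 * s) ^ 2 = ((23 * (4 * n - m ^ 2) : ℤ) : ℚ) := by
    push_cast
    rw [← hm, ← hn]
    ring
  obtain ⟨k, hk⟩ : ∃ k : ℤ, 23 * s = k := by
    have hx_int : IsIntegral ℤ ((23 * s) ^ 2) := by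
      rw [hsq]
      exact map_isIntegral_int (Int.castRingHom ℚ) (isIntegral_algebraMap (R := ℤ))
    obtain ⟨k, hk⟩ := IsIntegrallyClosed.isIntegral_iff.1 (hx_int.of_pow two_pos)
    exact ⟨k, hk.symm⟩
  have hk2 : k ^ 2 = 23 * (4 * n - m ^ 2) := by
    rw [hk] at hsq
    exact_mod_cast hsq
  obtain ⟨s', rfl⟩ : (23 : ℤ) ∣ k :=
    Int.Prime.dvd_pow' (by norm_num) ⟨_, hk2⟩
  have hs : s = s' := by
    push_cast at hk
    linarith
  have hodd : m ^ 2 = 4 * n - 23 * s' ^ 2 := by linarith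
  obtain ⟨r', hr'⟩ : (2 : ℤ) ∣ m - s' := by
    have : (m - s') * (m + s') = 2 * (2 * (n - 6 * s' ^ 2)) := by linear_combination hodd
    rcases Int.prime_two.dvd_or_dvd ⟨_, this⟩ with h | h <;> omega
  refine ⟨r', s', ?_, hs⟩
  have : (m : ℚ) - s' = 2 * r' := by exact_mod_cast hr'
  linarith

namespace IsCubicSplittingField

variable {L : Type*} [Field L] [CharZero L] {a b : L} {σ τ : L →+* L}

theorem exists_int_eq_add_mul_of_map_eq (h : IsCubicSplittingField a b σ τ) {x : L}
    (hx : σ x = x) (hx_int : IsIntegral ℤ x) :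
    ∃ r s : ℤ, x = r + s * (-1 - a + b - 3 * a ^ 2 * b) := by
  obtain ⟨r, s, rfl⟩ := h.exists_eq_add_mul_of_map_eq hx
  set θ := -1 - a + b - 3 * a ^ 2 * b with hθ
  have hθ2 : θ ^ 2 - θ + 6 = 0 := h.quadratic_root_eq
  have hτθ : τ θ = 1 - θ := by
    simp only [hθ, map_sub, map_add, map_neg, map_one, map_mul, map_pow, map_ofNat,
      h.swap_root.1, h.swap_root.2]
    linear_combination -3 * h.cubic_eq
  have hτ : τ (r + s * θ) = r + s * (1 - θ) := by
    simp only [map_add, map_mul, map_ratCast, hτθ]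
  have hconj : IsIntegral ℤ ((r : L) + s * (1 - θ)) := hτ ▸ map_isIntegral_int τ hx_int
  have hrat {q : ℚ} {y : L} (hy : IsIntegral ℤ y) (hq : y = q) : ∃ k : ℤ, q = k := by
    obtain ⟨k, hk⟩ := IsIntegrallyClosed.isIntegral_iff.1
      ((isIntegral_algebraMap_iff (B := L) (algebraMap ℚ L).injective).1 (hq ▸ hy))
    exact ⟨k, hk.symm⟩
  obtain ⟨m, hm⟩ := hrat (q := 2 * r + s) (hx_int.add hconj) (by
    push_cast
    ring)
  obtain ⟨n, hn⟩ := hrat (q := r ^ 2 + r * s + 6 * s ^ 2) (hx_int.mul hconj) (by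
    push_cast
    linear_combination -(s : L) ^ 2 * hθ2)
  obtain ⟨r', s', rfl, rfl⟩ := Rat.exists_eq_intCast_of_trace_norm hm hn
  exact ⟨r', s', by simp⟩

end IsCubicSplittingField

theorem IsCubicSplittingField.two_mul_cubicNormForm_ne {L : Type*} [Field L] [CharZero L] {a b : L}
    {σ τ : L →+* L} (h : IsCubicSplittingField a b σ τ) {x y : ℤ} (hxy : IsCoprime x y)
    (D z w : ℤ) (hD : D ≠ 0) :
    2 * cubicNormForm (D * x) z w ≠ D ^ 3 * ((x - y) * (x ^ 2 + x * y + 6 * y ^ 2)) := by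
  have := h.numberField
  have := h.isPrincipalIdealRing
  let A : NumberField.RingOfIntegers L := ⟨a, h.isIntegral_fst⟩
  let B : NumberField.RingOfIntegers L := ⟨b, h.isIntegral_snd⟩
  have hA : (A : L) = a := rfl
  have hB : (B : L) = b := rfl
  let s := NumberField.RingOfIntegers.mapRingHom σ
  have hs (x : NumberField.RingOfIntegers L) : (s x : L) = σ x := rfl
  have hext {x y : NumberField.RingOfIntegers L} (hxy : (x : L) = y) : x = y :=
    NumberField.RingOfIntegers.ext hxy
  have hsA : s A = B := hext h.map_root.1
  have hsB : s B = -A - B := hext (by simp [hs, hA, hB, h.map_root.2])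
  have hAB : A ^ 2 + A * B + B ^ 2 = 1 := hext h.quadratic_eq
  have hAB' : A ^ 2 * B + A * B ^ 2 = -1 := hext h.cubic_eq
  let θ := -1 - A + B - 3 * A ^ 2 * B
  have hθ : (θ : L) = -1 - a + b - 3 * a ^ 2 * b := rfl
  refine _root_.two_mul_cubicNormForm_ne (θ := θ) (σ := s) (hext h.quadratic_root_eq)
    (fun x => hext (h.pow_three_map x)) ?_ (fun x hx => ?_) hAB hAB' hsA hsB hxy D z w hD
  · simp only [θ, map_sub, map_add, map_neg, map_one, map_mul, map_pow, map_ofNat, hsA, hsB]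
    linear_combination 3 * B * hAB
  · obtain ⟨r, t, hrt⟩ := h.exists_int_eq_add_mul_of_map_eq (congrArg Subtype.val hx) x.2
    exact ⟨r, t, hext (by simp [hrt, hθ])⟩

/-- the original Birch--Swinnerton-Dyer example: let `φ` be the real
root of `t³ = t + 1` and `K₀ = ℚ(φ)`. The cubic surface
`2 N_{K₀/ℚ}(x + φ z + φ² w) = (x - y)(x² + x y + 6 y²)` fails the Hasse principle:
it has nontrivial points over `ℝ` and over `ℚ_p` for every prime `p`, but not over `ℚ`.
Here `N` is the rational norm form, characterised by
`N(x, z, w) = ∏ᵢ (x + φᵢ z + φᵢ² w)` over `ℂ`, the `φᵢ` being the conjugates of `φ`. -/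
theorem bsd_example_fails_hasse_principle
    (φ : ℝ) (hφ : φ ^ 3 = φ + 1)
    (φc : Fin 3 → ℂ) (hφc : ∀ i, (φc i) ^ 3 = φc i + 1)
    (hφinj : Function.Injective φc) (hφ0 : φc 0 = (φ : ℂ))
    (N : MvPolynomial (Fin 3) ℚ)
    (hN : ∀ x z w : ℂ, MvPolynomial.aeval ![x, z, w] N
        = ∏ i : Fin 3, (x + φc i * z + (φc i) ^ 2 * w)) :
    (∃ x y z w : ℝ, ¬(x = 0 ∧ y = 0 ∧ z = 0 ∧ w = 0) ∧
        2 * MvPolynomial.aeval ![x, z, w] N = (x - y) * (x ^ 2 + x * y + 6 * y ^ 2)) ∧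
    (∀ (p : ℕ) [Fact p.Prime], ∃ x y z w : ℚ_[p], ¬(x = 0 ∧ y = 0 ∧ z = 0 ∧ w = 0) ∧
        2 * MvPolynomial.aeval ![x, z, w] N = (x - y) * (x ^ 2 + x * y + 6 * y ^ 2)) ∧
    ¬(∃ x y z w : ℚ, ¬(x = 0 ∧ y = 0 ∧ z = 0 ∧ w = 0) ∧
        2 * MvPolynomial.aeval ![x, z, w] N = (x - y) * (x ^ 2 + x * y + 6 * y ^ 2)) := by
  simp only [aeval_eq_cubicNormForm φc hφc hφinj N hN]
  refine ⟨?_, fun p _ => ?_, ?_⟩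
  · refine ⟨0, -(1 / 3 : ℝ) ^ (1 / 3 : ℝ), 1, 0, by simp, ?_⟩
    have h : ((1 / 3 : ℝ) ^ (1 / 3 : ℝ)) ^ 3 = 1 / 3 := by
      rw [← Real.rpow_natCast, ← Real.rpow_mul (by norm_num)]
      norm_num
    simp only [cubicNormForm]
    linear_combination -6 * h
  · obtain ⟨x, y, z, w, h0, h⟩ := exists_padicInt_point p
    refine ⟨x, y, z, w, by simpa using h0, ?_⟩
    have h := congrArg (PadicInt.Coe.ringHom (p := p)) h
    simp only [cubicNormForm, map_mul, map_add, map_sub, map_pow, map_ofNat] at h ⊢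
    have hcoe (u : ℤ_[p]) : PadicInt.Coe.ringHom u = (u : ℚ_[p]) := rfl
    simp only [hcoe] at h
    linear_combination h
  · rintro ⟨x, y, z, w, h0, h⟩
    obtain ⟨L, _, _, a, b, σ, τ, hL⟩ := exists_isCubicSplittingField φ hφ
    exact h0 (eq_zero_of_two_mul_cubicNormForm_eq
      (fun _ _ hxy D z w hD => hL.two_mul_cubicNormForm_ne hxy D z w hD) h)
end
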